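/- arXiv:1509.03589 — 2 statements merged into one kernel-verified Lean document; each statement's English description precedes it below -/
import Mathlib

section
/- For Lebesgue almost every λ ∈ (1/2, 0.668), the box dimension of the inhomogeneous attractor F_C^λ exists and equals log(4λ)/log 2. -/
open Filter MeasureTheory

/-- The number of cubes from the `δ`-mesh on `ℝ^d` (products of half-open intervals
`[aδ, (a+1)δ)`, `a ∈ ℤ`) that intersect `E`. -/
noncomputable def meshCount (d : ℕ) (δ : ℝ) (E : Set (Fin d → ℝ)) : ℕ :=
  Set.ncard {a : Fin d → ℤ | ∃ x ∈ E, ∀ i, (a i : ℝ) * δ ≤ x i ∧ x i < ((a i : ℝ) + 1) * δ}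

/-- The upper box dimension of `E ⊆ ℝ^d`. -/
noncomputable def upperBoxDim (d : ℕ) (E : Set (Fin d → ℝ)) : ℝ :=
  limsup (fun δ : ℝ => Real.log (meshCount d δ E) / (-Real.log δ)) (nhdsWithin 0 (Set.Ioi 0))

/-- The lower box dimension of `E ⊆ ℝ^d`. -/
noncomputable def lowerBoxDim (d : ℕ) (E : Set (Fin d → ℝ)) : ℝ :=
  liminf (fun δ : ℝ => Real.log (meshCount d δ E) / (-Real.log δ)) (nhdsWithin 0 (Set.Ioi 0))

/-- Polynomials all of whose coefficients lie in `{-1, 0, 1}`. -/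
inductive SignPoly : Polynomial ℝ → Prop
  | zero : SignPoly 0
  | cons (b : ℤ) (hb : |b| ≤ 1) (g : Polynomial ℝ) (hg : SignPoly g) :
      SignPoly (Polynomial.C (b : ℝ) + Polynomial.X * g)

lemma abs_add_mul_le {b x t B B' : ℝ} (hb : |b| ≤ B') (hx : 0 ≤ x) (ht : |t| ≤ B) :
    |b + x * t| ≤ B' + x * B := by
  refine (abs_add_le _ _).trans (add_le_add hb ?_)
  rw [abs_mul, abs_of_nonneg hx]
  gcongr

lemma abs_intCast_le_one {b : ℤ} (hb : |b| ≤ 1) : |(b : ℝ)| ≤ 1 := by exact_mod_cast hb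

namespace SignPoly

variable {g : Polynomial ℝ} {x : ℝ}

lemma abs_eval_le (hg : SignPoly g) (hx : 0 ≤ x) (hx1 : x < 1) : |g.eval x| ≤ 1 / (1 - x) := by
  have h : 0 < 1 - x := by linarith
  induction hg with
  | zero => simpa using h.le
  | cons b hb g hg ih =>
    have := abs_add_mul_le (abs_intCast_le_one hb) hx ih
    simp only [Polynomial.eval_add, Polynomial.eval_mul, Polynomial.eval_X, Polynomial.eval_C]
    refine this.trans (le_of_eq ?_)
    field_simp
    ring

lemma abs_eval_derivative_le (hg : SignPoly g) (hx : 0 ≤ x) (hx1 : x < 1) :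
    |g.derivative.eval x| ≤ 1 / (1 - x) ^ 2 := by
  have h : 0 < 1 - x := by linarith
  induction hg with
  | zero => simp; positivity
  | cons b hb g hg ih =>
    have := abs_add_mul_le (hg.abs_eval_le hx hx1) hx ih
    simp only [Polynomial.derivative_add, Polynomial.derivative_mul, Polynomial.derivative_C,
      Polynomial.derivative_X, Polynomial.eval_add, Polynomial.eval_mul, Polynomial.eval_X,
      zero_add, one_mul]
    refine this.trans (le_of_eq ?_)
    field_simp
    ring

lemma abs_eval_derivative_derivative_le (hg : SignPoly g) (hx : 0 ≤ x) (hx1 : x < 1) :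
    |g.derivative.derivative.eval x| ≤ 2 / (1 - x) ^ 3 := by
  have h : 0 < 1 - x := by linarith
  induction hg with
  | zero => simp; positivity
  | cons b hb g hg ih =>
    have h1 : |2 * g.derivative.eval x| ≤ 2 * (1 / (1 - x) ^ 2) := by
      rw [abs_mul, abs_two]
      gcongr
      exact hg.abs_eval_derivative_le hx hx1
    have := abs_add_mul_le h1 hx ih
    simp only [Polynomial.derivative_add, Polynomial.derivative_mul, Polynomial.derivative_C,
      Polynomial.derivative_X, Polynomial.eval_add, Polynomial.eval_mul, Polynomial.eval_X,
      zero_add, one_mul]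
    rw [← add_assoc, ← two_mul]
    refine this.trans (le_of_eq ?_)
    field_simp
    ring

lemma abs_eval_sub_mul_derivative_le (hg : SignPoly g) (hx : 0 ≤ x) (hx1 : x < 1) :
    |g.eval x - x * g.derivative.eval x| ≤ 1 + x ^ 2 / (1 - x) ^ 2 := by
  have h : 0 < 1 - x := by linarith
  cases hg with
  | zero => simp; positivity
  | cons b hb g hg =>
    have := abs_add_mul_le (abs_intCast_le_one hb) (sq_nonneg x)
      ((abs_neg _).trans_le (hg.abs_eval_derivative_le hx hx1))
    simp only [Polynomial.derivative_add, Polynomial.derivative_mul, Polynomial.derivative_C,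
      Polynomial.derivative_X, Polynomial.eval_add, Polynomial.eval_mul, Polynomial.eval_X,
      zero_add, one_mul, Polynomial.eval_C]
    convert this using 2 <;> ring

end SignPoly

/-- Branch and bound over sign polynomials `p + x ^ n * t` at `x = A / D`, where
`P = D ^ n * p(x)`, `Q = D ^ n * x * p'(x)`, `c = A ^ n` and `d = D ^ n`. The value `true` certifies
that no tail `t` makes the value at most `112 (R / D) ^ 2` and the derivative at most
`56 (R / D)` in absolute value. -/
def noSmallJet (A D R : ℤ) : ℕ → ℤ → ℤ → ℤ → ℤ → ℤ → Bool
  | 0, _, _, _, _, _ => false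
  | k + 1, n, P, Q, c, d =>
    let U := P * (D - A) * D ^ 2
    let u := c * D ^ 3 + 112 * R ^ 2 * d * (D - A)
    let V := ((n + 1) * P - Q) * (D - A) ^ 2 * D ^ 2
    let v := c * ((D - A) ^ 2 + A ^ 2) * D ^ 2 +
      d * (D - A) ^ 2 * ((n + 1) * 112 * R ^ 2 + 56 * A * R)
    decide (u < U) || decide (u < -U) || decide (v < V) || decide (v < -V) ||
      (noSmallJet A D R k (n + 1) (D * (P - c)) (D * (Q - n * c)) (c * A) (d * D) &&
       noSmallJet A D R k (n + 1) (D * P) (D * Q) (c * A) (d * D) &&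
       noSmallJet A D R k (n + 1) (D * (P + c)) (D * (Q + n * c)) (c * A) (d * D))

lemma noSmallJet_sound {A D R : ℤ} (hA : 0 < A) (hAD : A < D) {x r : ℝ}
    (hx : (A : ℝ) = D * x) (hr : (R : ℝ) = D * r) (k : ℕ) :
    ∀ (n P Q c d : ℤ), 0 ≤ n → 0 < c → 0 < d → noSmallJet A D R k n P Q c d = true →
      ∀ g, SignPoly g →
        |P + c * g.eval x| ≤ d * (112 * r ^ 2) →
        |Q + c * (n * g.eval x + x * g.derivative.eval x)| ≤ d * (x * (56 * r)) → False := by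
  have hD : (0 : ℝ) < D := by exact_mod_cast hA.trans hAD
  have hx0 : 0 < x := by
    have : (0 : ℝ) < D * x := by rw [← hx]; exact_mod_cast hA
    exact pos_of_mul_pos_right this hD.le
  have hx1 : x < 1 := by
    have : (D : ℝ) * x < D := by rw [← hx]; exact_mod_cast hAD
    nlinarith
  have h1x : 0 < 1 - x := by linarith
  induction k with
  | zero => intro n P Q c d _ _ _ h; simp [noSmallJet] at h
  | succ k ih =>
    intro n P Q c d hn hc hd h g hg hP hQ
    have hc' : (0 : ℝ) < c := by exact_mod_cast hc
    have hd' : (0 : ℝ) < d := by exact_mod_cast hd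
    have hn' : (0 : ℝ) ≤ n := by exact_mod_cast hn
    have hval : |(P : ℝ)| ≤ c * (1 / (1 - x)) + d * (112 * r ^ 2) := by
      have h1 := hg.abs_eval_le hx0.le hx1
      have h2 : |(c : ℝ) * g.eval x| ≤ c * (1 / (1 - x)) := by
        rw [abs_mul, abs_of_pos hc']; gcongr
      have := abs_sub (P + c * g.eval x) (c * g.eval x)
      rw [add_sub_cancel_right] at this
      linarith
    have hfun : |((n : ℝ) + 1) * P - Q| ≤ c * (1 + x ^ 2 / (1 - x) ^ 2) +
        (n + 1) * (d * (112 * r ^ 2)) + d * (x * (56 * r)) := by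
      have h1 := hg.abs_eval_sub_mul_derivative_le hx0.le hx1
      have h2 : |(c : ℝ) * (g.eval x - x * g.derivative.eval x)| ≤
          c * (1 + x ^ 2 / (1 - x) ^ 2) := by
        rw [abs_mul, abs_of_pos hc']; gcongr
      have h3 : |((n : ℝ) + 1) * (P + c * g.eval x)| ≤ (n + 1) * (d * (112 * r ^ 2)) := by
        rw [abs_mul, abs_of_nonneg (by linarith : (0 : ℝ) ≤ n + 1)]; gcongr
      rw [abs_le] at *
      constructor <;> nlinarith
    have hDA : (0 : ℝ) < D * (1 - x) := by positivity
    have hU : |(P * (D - A) * D ^ 2 : ℝ)| ≤ c * D ^ 3 + 112 * R ^ 2 * d * (D - A) := by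
      have e : (D : ℝ) - A = D * (1 - x) := by rw [hx]; ring
      rw [e, hr, mul_assoc, abs_mul, abs_of_pos (by positivity : 0 < D * (1 - x) * (D : ℝ) ^ 2)]
      calc |(P : ℝ)| * (D * (1 - x) * D ^ 2)
          ≤ (c * (1 / (1 - x)) + d * (112 * r ^ 2)) * (D * (1 - x) * D ^ 2) := by gcongr
        _ = _ := by field_simp
    have hV : |(((n + 1) * P - Q) * (D - A) ^ 2 * D ^ 2 : ℝ)| ≤
        c * (((D : ℝ) - A) ^ 2 + A ^ 2) * D ^ 2 +
          d * (D - A) ^ 2 * ((n + 1) * 112 * R ^ 2 + 56 * A * R) := by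
      have e : (D : ℝ) - A = D * (1 - x) := by rw [hx]; ring
      rw [e, hr, hx, mul_assoc, abs_mul,
        abs_of_pos (by positivity : 0 < (D * (1 - x)) ^ 2 * (D : ℝ) ^ 2)]
      calc |((n : ℝ) + 1) * P - Q| * ((D * (1 - x)) ^ 2 * D ^ 2)
          ≤ (c * (1 + x ^ 2 / (1 - x) ^ 2) + (n + 1) * (d * (112 * r ^ 2)) +
              d * (x * (56 * r))) * ((D * (1 - x)) ^ 2 * D ^ 2) := by gcongr
        _ = _ := by field_simp; ring
    rw [abs_le'] at hU hV
    have hstep : ∀ (b : ℤ) (g' : Polynomial ℝ), SignPoly g' →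
        g = Polynomial.C (b : ℝ) + Polynomial.X * g' →
        noSmallJet A D R k (n + 1) (D * (P + c * b)) (D * (Q + n * (c * b))) (c * A) (d * D) = true →
        False := by
      intro b g' hg' hgg' hk
      have hD' : 0 < D := hA.trans hAD
      refine ih _ _ _ _ _ (by omega) (by positivity) (by positivity) hk g' hg' ?_ ?_
      · have : ((D * (P + c * b) : ℤ) : ℝ) + ((c * A : ℤ) : ℝ) * g'.eval x =
            D * (P + c * g.eval x) := by
          rw [hgg']; push_cast; rw [hx]; simp; ring
        rw [this, abs_mul, abs_of_pos hD]
        push_cast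
        nlinarith
      · have : ((D * (Q + n * (c * b)) : ℤ) : ℝ) + ((c * A : ℤ) : ℝ) *
            (((n + 1 : ℤ) : ℝ) * g'.eval x + x * g'.derivative.eval x) =
            D * (Q + c * (n * g.eval x + x * g.derivative.eval x)) := by
          rw [hgg']; push_cast; rw [hx]; simp; ring
        rw [this, abs_mul, abs_of_pos hD]
        push_cast
        nlinarith
    simp only [noSmallJet, Bool.or_eq_true, Bool.and_eq_true, decide_eq_true_eq] at h
    rcases h with (((h | h) | h) | h) | ⟨⟨hm, h0⟩, hp⟩
    · exact absurd hU.1 (not_le.2 (by exact_mod_cast h))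
    · exact absurd hU.2 (not_le.2 (by exact_mod_cast h))
    · exact absurd hV.1 (not_le.2 (by exact_mod_cast h))
    · exact absurd hV.2 (not_le.2 (by exact_mod_cast h))
    · cases hg with
      | zero =>
        refine hstep 0 0 .zero (by simp) ?_
        simpa using h0
      | cons b hb g' hg' =>
        refine hstep b g' hg' rfl ?_
        rw [abs_le] at hb
        obtain rfl | rfl | rfl : b = -1 ∨ b = 0 ∨ b = 1 := by omega
        · simpa [sub_eq_add_neg] using hm
        · simpa using h0
        · simpa using hp

/-- A set on which sign polynomials with nonzero constant term satisfy a uniform linear bound on the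
measure of their sublevel sets. -/
def Transversal (I : Set ℝ) : Prop :=
  ∃ K : ℝ, 0 ≤ K ∧ ∀ g, SignPoly g → ∀ b : ℤ, |b| = 1 → ∀ ρ : ℝ, 0 ≤ ρ →
    volume (I ∩ {x | |(Polynomial.C (b : ℝ) + Polynomial.X * g).eval x| ≤ ρ}) ≤
      ENNReal.ofReal (K * ρ)

lemma Transversal.union {I J : Set ℝ} (hI : Transversal I) (hJ : Transversal J) :
    Transversal (I ∪ J) := by
  obtain ⟨K, hK, hI⟩ := hI
  obtain ⟨L, hL, hJ⟩ := hJ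
  refine ⟨K + L, by positivity, fun g hg b hb ρ hρ => ?_⟩
  rw [Set.union_inter_distrib_right, add_mul, ENNReal.ofReal_add (by positivity) (by positivity)]
  exact (measure_union_le _ _).trans (add_le_add (hI g hg b hb ρ hρ) (hJ g hg b hb ρ hρ))

lemma transversal_of_forall {I : Set ℝ} {l η : ℝ} (hη : 0 < η) (hI : I.OrdConnected)
    (hl : volume I ≤ ENNReal.ofReal l) (hl0 : 0 ≤ l)
    (h : ∀ g, SignPoly g → ∀ b : ℤ, |b| = 1 →
      (∀ x ∈ I, η ≤ |(Polynomial.C (b : ℝ) + Polynomial.X * g).eval x|) ∨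
      (∀ x ∈ I, η ≤ |(Polynomial.C (b : ℝ) + Polynomial.X * g).derivative.eval x|)) :
    Transversal I := by
  refine ⟨l / η + 2 / η, by positivity, fun g hg b hb ρ hρ => ?_⟩
  have hdiv := h g hg b hb
  generalize Polynomial.C (b : ℝ) + Polynomial.X * g = f at hdiv
  rcases hdiv with hv | hv
  · rcases lt_or_ge ρ η with hlt | hge
    · have : I ∩ {x | |f.eval x| ≤ ρ} = ∅ := by
        ext x
        simp only [Set.mem_inter_iff, Set.mem_ofPred_eq, Set.mem_empty_iff_false, iff_false, not_and,
          not_le]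
        exact fun hx => hlt.trans_le (hv x hx)
      simp [this]
    · refine (measure_mono Set.inter_subset_left).trans (hl.trans (ENNReal.ofReal_le_ofReal ?_))
      have h1 : l ≤ l / η * ρ := by
        rw [div_mul_eq_mul_div, le_div_iff₀ hη]; gcongr
      have h2 : 0 ≤ 2 / η * ρ := by positivity
      linarith
  · refine (Real.volume_le_diam _).trans (Metric.ediam_le fun x hx y hy => ?_)
    rw [edist_dist, Real.dist_eq]
    refine ENNReal.ofReal_le_ofReal ?_
    wlog hxy : x < y generalizing x y
    · rcases (not_lt.1 hxy).eq_or_lt with rfl | hlt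
      · simp; positivity
      · rw [abs_sub_comm]; exact this y hy x hx hlt
    obtain ⟨ξ, hξ, he⟩ := exists_deriv_eq_slope (fun z => f.eval z) hxy
      f.continuous.continuousOn f.differentiable.differentiableOn
    rw [Polynomial.deriv] at he
    have h1 := hv ξ (hI.out hx.1 hy.1 ⟨hξ.1.le, hξ.2.le⟩)
    have h0 : 0 < y - x := by linarith
    rw [he, abs_div, abs_of_pos h0, le_div_iff₀ h0] at h1
    have h2 : |f.eval y - f.eval x| ≤ 2 * ρ := by
      have := abs_sub (f.eval y) (f.eval x)
      have := hx.2; have := hy.2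
      simp only [Set.mem_ofPred_eq] at *
      linarith
    rw [abs_sub_comm, abs_of_pos h0]
    have h3 : y - x ≤ 2 / η * ρ := by
      rw [div_mul_eq_mul_div, le_div_iff₀ hη]; linarith
    have : 0 ≤ l / η * ρ := by positivity
    linarith

lemma SignPoly.neg {g : Polynomial ℝ} (hg : SignPoly g) : SignPoly (-g) := by
  induction hg with
  | zero => simpa using SignPoly.zero
  | cons b hb g hg ih =>
    have := SignPoly.cons (-b) (by simpa using hb) _ ih
    convert this using 1
    push_cast
    rw [Polynomial.C_neg]
    ring

lemma transversal_of_noSmallJet {A D R : ℤ} (hA : R < A) (hAD : 1000 * (A + R) ≤ 668 * D)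
    (hR : 0 < R) (k : ℕ) (h : noSmallJet A D R k 1 D 0 A D = true) :
    Transversal (Set.Icc (((A - R : ℤ) : ℝ) / D) (((A + R : ℤ) : ℝ) / D)) := by
  have hD : 0 < D := by omega
  have hD' : (0 : ℝ) < D := by exact_mod_cast hD
  obtain ⟨x, hx⟩ : ∃ x : ℝ, x = A / D := ⟨_, rfl⟩
  obtain ⟨r, hr⟩ : ∃ r : ℝ, r = R / D := ⟨_, rfl⟩
  have hr0 : 0 < r := by rw [hr]; have : (0 : ℝ) < R := by exact_mod_cast hR
                         positivity
  have hxr : r < x := by rw [hr, hx]; gcongr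
  have hx1 : x + r ≤ 0.668 := by
    rw [hx, hr, ← add_div, div_le_iff₀ hD']
    have : (1000 * (A + R) : ℝ) ≤ 668 * D := by exact_mod_cast hAD
    linarith
  have hI : Set.Icc (((A - R : ℤ) : ℝ) / D) (((A + R : ℤ) : ℝ) / D) = Set.Icc (x - r) (x + r) := by
    rw [hx, hr]; push_cast; rw [add_div, sub_div]
  rw [hI]
  have hxI : x ∈ Set.Icc (x - r) (x + r) := ⟨by linarith, by linarith⟩
  refine transversal_of_forall (l := 2 * r) (η := min r (r ^ 2)) (by positivity) Set.ordConnected_Icc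
    (by rw [Real.volume_Icc]; apply ENNReal.ofReal_le_ofReal; linarith) (by positivity) ?_
  have key : ∀ g, SignPoly g → 112 * r ^ 2 < |(Polynomial.C 1 + Polynomial.X * g).eval x| ∨
      56 * r < |(Polynomial.C 1 + Polynomial.X * g).derivative.eval x| := by
    intro g hg
    by_contra! hcon
    have hAx : (A : ℝ) = D * x := by rw [hx]; field_simp
    refine noSmallJet_sound (x := x) (r := r) (by omega) (by omega) hAx
      (by rw [hr]; field_simp) k 1 D 0 A D (by norm_num) (by omega) hD h g hg ?_ ?_
    · have : (D : ℝ) + A * g.eval x = D * (Polynomial.C 1 + Polynomial.X * g).eval x := by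
        rw [hAx]; simp; ring
      rw [this, abs_mul, abs_of_pos hD']
      exact mul_le_mul_of_nonneg_left hcon.1 hD'.le
    · have : ((0 : ℤ) : ℝ) + A * (((1 : ℤ) : ℝ) * g.eval x + x * g.derivative.eval x) =
          D * (x * (Polynomial.C 1 + Polynomial.X * g).derivative.eval x) := by
        rw [hAx]; simp; ring
      rw [this, abs_mul, abs_of_pos hD', abs_mul, abs_of_pos (hr0.trans hxr)]
      have := hr0.trans hxr
      gcongr
      exact hcon.2
  have main : ∀ g, SignPoly g →
      (∀ y ∈ Set.Icc (x - r) (x + r),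
        min r (r ^ 2) ≤ |(Polynomial.C 1 + Polynomial.X * g).eval y|) ∨
      (∀ y ∈ Set.Icc (x - r) (x + r),
        min r (r ^ 2) ≤ |(Polynomial.C 1 + Polynomial.X * g).derivative.eval y|) := by
    intro g hg
    have hkey := key g hg
    have hf : SignPoly (Polynomial.C 1 + Polynomial.X * g) := by
      simpa using SignPoly.cons 1 (by norm_num) g hg
    generalize Polynomial.C 1 + Polynomial.X * g = f at hkey hf
    have hd : ∀ y ∈ Set.Icc (x - r) (x + r),
        |f.derivative.eval y - f.derivative.eval x| ≤ 55 * r := by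
      intro y hy
      have hb : ∀ z ∈ Set.Icc (x - r) (x + r), ‖deriv (fun w => f.derivative.eval w) z‖ ≤ 55 := by
        intro z hz
        rw [Polynomial.deriv, Real.norm_eq_abs]
        refine (hf.abs_eval_derivative_derivative_le (by linarith [hz.1])
          (by norm_num at hx1; linarith [hz.2])).trans ?_
        have h3 : (0.332 : ℝ) ≤ 1 - z := by norm_num at hx1 ⊢; linarith [hz.2]
        calc 2 / (1 - z) ^ 3 ≤ 2 / 0.332 ^ 3 := by gcongr
          _ ≤ 55 := by norm_num
      have := (convex_Icc (x - r) (x + r)).norm_image_sub_le_of_norm_deriv_le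
        (fun z _ => f.derivative.differentiable z) hb hxI hy
      rw [Real.norm_eq_abs, Real.norm_eq_abs] at this
      refine this.trans ?_
      gcongr
      rw [abs_le]; constructor <;> linarith [hy.1, hy.2]
    rcases le_or_gt |f.derivative.eval x| (56 * r) with hle | hlt
    · left
      have hv := hkey.resolve_right (not_lt.2 hle)
      intro y hy
      have hb : ∀ z ∈ Set.Icc (x - r) (x + r), ‖deriv (fun w => f.eval w) z‖ ≤ 111 * r := by
        intro z hz
        rw [Polynomial.deriv, Real.norm_eq_abs]
        have := hd z hz
        have := abs_sub_abs_le_abs_sub (f.derivative.eval z) (f.derivative.eval x)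
        linarith
      have := (convex_Icc (x - r) (x + r)).norm_image_sub_le_of_norm_deriv_le
        (fun z _ => f.differentiable z) hb hy hxI
      rw [Real.norm_eq_abs, Real.norm_eq_abs] at this
      have h2 : |x - y| ≤ r := by rw [abs_le]; constructor <;> linarith [hy.1, hy.2]
      have h3 : 111 * r * |x - y| ≤ 111 * r * r := by gcongr
      have := abs_sub_abs_le_abs_sub (f.eval x) (f.eval y)
      refine (min_le_right _ _).trans ?_
      nlinarith
    · right
      intro y hy
      have := hd y hy
      have := abs_sub_abs_le_abs_sub (f.derivative.eval x) (f.derivative.eval y)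
      rw [abs_sub_comm] at this
      refine (min_le_left _ _).trans ?_
      linarith
  intro g hg b hb
  obtain rfl | rfl : b = 1 ∨ b = -1 := by
    rcases abs_eq (by norm_num : (0 : ℤ) ≤ 1) |>.1 hb with h | h <;> simp [h]
  · simpa using main g hg
  · have := main (-g) hg.neg
    have e : Polynomial.C (((-1 : ℤ)) : ℝ) + Polynomial.X * g =
        -(Polynomial.C 1 + Polynomial.X * (-g)) := by
      push_cast; rw [Polynomial.C_neg]; ring
    rw [e]
    simpa only [Polynomial.derivative_neg, Polynomial.eval_neg, abs_neg] using this

lemma transversal_Icc : Transversal (Set.Icc 0.5 0.668) := by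
  have trans : ∀ {a b c : ℝ}, a ≤ b → b ≤ c → Transversal (Set.Icc a b) →
      Transversal (Set.Icc b c) → Transversal (Set.Icc a c) := fun h1 h2 h3 h4 => by
    rw [← Set.Icc_union_Icc_eq_Icc h1 h2]; exact h3.union h4
  have cert : ∀ (A R : ℤ), R < A → 1000 * (A + R) ≤ 668 * 100000 → 0 < R →
      noSmallJet A 100000 R 20 1 100000 0 A 100000 = true →
      ∀ a b : ℝ, a = (A - R) / 100000 → b = (A + R) / 100000 → Transversal (Set.Icc a b) := by
    rintro A R h1 h2 h3 h4 a b rfl rfl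
    simpa using transversal_of_noSmallJet h1 h2 h3 20 h4
  refine trans (b := 0.54) (by norm_num) (by norm_num)
    (cert 52000 2000 (by norm_num) (by norm_num) (by norm_num) (by decide +kernel) _ _
      (by norm_num) (by norm_num)) ?_
  refine trans (b := 0.57214) (by norm_num) (by norm_num)
    (cert 55607 1607 (by norm_num) (by norm_num) (by norm_num) (by decide +kernel) _ _
      (by norm_num) (by norm_num)) ?_
  refine trans (b := 0.60934) (by norm_num) (by norm_num)
    (cert 59074 1860 (by norm_num) (by norm_num) (by norm_num) (by decide +kernel) _ _
      (by norm_num) (by norm_num)) ?_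
  refine trans (b := 0.62862) (by norm_num) (by norm_num)
    (cert 61898 964 (by norm_num) (by norm_num) (by norm_num) (by decide +kernel) _ _
      (by norm_num) (by norm_num)) ?_
  refine trans (b := 0.6418) (by norm_num) (by norm_num)
    (cert 63521 659 (by norm_num) (by norm_num) (by norm_num) (by decide +kernel) _ _
      (by norm_num) (by norm_num)) ?_
  refine trans (b := 0.65268) (by norm_num) (by norm_num)
    (cert 64724 544 (by norm_num) (by norm_num) (by norm_num) (by decide +kernel) _ _
      (by norm_num) (by norm_num)) ?_
  refine trans (b := 0.66002) (by norm_num) (by norm_num)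
    (cert 65635 367 (by norm_num) (by norm_num) (by norm_num) (by decide +kernel) _ _
      (by norm_num) (by norm_num)) ?_
  refine trans (b := 0.66444) (by norm_num) (by norm_num)
    (cert 66223 221 (by norm_num) (by norm_num) (by norm_num) (by decide +kernel) _ _
      (by norm_num) (by norm_num)) ?_
  refine trans (b := 0.66624) (by norm_num) (by norm_num)
    (cert 66534 90 (by norm_num) (by norm_num) (by norm_num) (by decide +kernel) _ _
      (by norm_num) (by norm_num)) ?_
  refine trans (b := 0.66752) (by norm_num) (by norm_num)
    (cert 66688 64 (by norm_num) (by norm_num) (by norm_num) (by decide +kernel) _ _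
      (by norm_num) (by norm_num)) ?_
  exact cert 66776 24 (by norm_num) (by norm_num) (by norm_num) (by decide +kernel) _ _
      (by norm_num) (by norm_num)

/-- The numerical value of a binary letter. -/
def digit (e : Bool) : ℤ := cond e 1 0

/-- The polynomial whose coefficients are the letters of a binary word. -/
noncomputable def wordPoly : (k : ℕ) → (Fin k → Bool) → Polynomial ℝ
  | 0, _ => 0
  | k + 1, u => Polynomial.C (digit (u 0) : ℝ) + Polynomial.X * wordPoly k (Fin.tail u)

lemma wordPoly_cons (k : ℕ) (e : Bool) (u : Fin k → Bool) :
    wordPoly (k + 1) (Fin.cons e u : Fin (k + 1) → Bool) =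
      Polynomial.C (digit e : ℝ) + Polynomial.X * wordPoly k u := by
  simp [wordPoly]

lemma wordPoly_cons_sub_cons (k : ℕ) (e f : Bool) (u v : Fin k → Bool) :
    wordPoly (k + 1) (Fin.cons e u : Fin (k + 1) → Bool) -
        wordPoly (k + 1) (Fin.cons f v : Fin (k + 1) → Bool) =
      Polynomial.C ((digit e - digit f : ℤ) : ℝ) +
        Polynomial.X * (wordPoly k u - wordPoly k v) := by
  rw [wordPoly_cons, wordPoly_cons]
  push_cast
  rw [Polynomial.C_sub]
  ring

lemma signPoly_wordPoly_sub (k : ℕ) (u v : Fin k → Bool) :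
    SignPoly (wordPoly k u - wordPoly k v) := by
  induction k with
  | zero => simpa [wordPoly] using SignPoly.zero
  | succ k ih =>
    rw [← Fin.cons_self_tail u, ← Fin.cons_self_tail v, wordPoly_cons_sub_cons]
    refine SignPoly.cons _ ?_ _ (ih _ _)
    cases u 0 <;> cases v 0 <;> simp [digit]

lemma sum_words_succ {M : Type*} [AddCommMonoid M] (k : ℕ) (f : (Fin (k + 1) → Bool) → M) :
    ∑ u, f u = ∑ e, ∑ u : Fin k → Bool, f (Fin.cons e u) := by
  rw [← (Fin.consEquiv fun _ => Bool).sum_comp f, Fintype.sum_prod_type]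
  rfl

lemma sum_volume_close_le {I : Set ℝ} {K : ℝ} (hI : ∀ x ∈ I, 1 / 2 ≤ x) (hvol : volume I ≤ 1)
    (hK : 0 ≤ K)
    (hT : ∀ g, SignPoly g → ∀ b : ℤ, |b| = 1 → ∀ ρ : ℝ, 0 ≤ ρ →
      volume (I ∩ {x | |(Polynomial.C (b : ℝ) + Polynomial.X * g).eval x| ≤ ρ}) ≤
        ENNReal.ofReal (K * ρ)) (k : ℕ) :
    ∀ δ : ℝ, 0 ≤ δ →
      ∑ u, ∑ v, volume (I ∩ {x | |(wordPoly k u - wordPoly k v).eval x| ≤ δ}) ≤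
        ENNReal.ofReal (2 ^ k + k * K * 4 ^ k * δ / 2) := by
  induction k with
  | zero =>
    intro δ hδ
    simp only [wordPoly, sub_zero, Polynomial.eval_zero, abs_zero, hδ, Set.ofPred_true,
      Set.inter_univ, Finset.univ_unique, Finset.sum_singleton]
    simpa using hvol
  | succ k ih =>
    intro δ hδ
    have hterm : ∀ (e f : Bool) (u v : Fin k → Bool),
        volume (I ∩ {x | |(wordPoly (k + 1) (Fin.cons e u : Fin (k + 1) → Bool) -
          wordPoly (k + 1) (Fin.cons f v : Fin (k + 1) → Bool)).eval x| ≤ δ}) ≤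
        if e = f then volume (I ∩ {x | |(wordPoly k u - wordPoly k v).eval x| ≤ 2 * δ})
        else ENNReal.ofReal (K * δ) := by
      intro e f u v
      rw [wordPoly_cons_sub_cons]
      split_ifs with hef
      · subst hef
        refine measure_mono fun x hx => ⟨hx.1, ?_⟩
        have h1 := hI x hx.1
        have h2 := hx.2
        simp only [sub_self, Int.cast_zero, Polynomial.C_0, zero_add, Polynomial.eval_mul,
          Polynomial.eval_X, Set.mem_ofPred_eq, abs_mul] at h2 ⊢
        rw [abs_of_nonneg (by linarith : (0 : ℝ) ≤ x)] at h2
        have := mul_le_mul_of_nonneg_right h1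
          (abs_nonneg ((wordPoly k u - wordPoly k v).eval x))
        linarith
      · refine hT _ (signPoly_wordPoly_sub k u v) _ ?_ δ hδ
        revert hef
        cases e <;> cases f <;> simp [digit]
    have hih := ih (2 * δ) (by positivity)
    have hcomm : ∀ e f : Bool, ∑ u : Fin k → Bool, ∑ v : Fin k → Bool,
        volume (I ∩ {x | |(wordPoly (k + 1) (Fin.cons e u : Fin (k + 1) → Bool) -
          wordPoly (k + 1) (Fin.cons f v : Fin (k + 1) → Bool)).eval x| ≤ δ}) ≤
        if e = f then ENNReal.ofReal (2 ^ k + k * K * 4 ^ k * (2 * δ) / 2)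
        else ENNReal.ofReal (4 ^ k * (K * δ)) := by
      intro e f
      refine (Finset.sum_le_sum fun u _ => Finset.sum_le_sum fun v _ => hterm e f u v).trans ?_
      split_ifs with hef
      · exact hih
      · rw [Finset.sum_const, Finset.sum_const, smul_smul, Finset.card_univ, nsmul_eq_mul,
          ENNReal.ofReal_mul (by positivity), Fintype.card_fun, Fintype.card_bool, Fintype.card_fin,
          ← mul_pow]
        norm_num [ENNReal.ofReal_mul hK]
    rw [sum_words_succ]
    simp_rw [sum_words_succ (f := fun v => volume (I ∩ {x | |(wordPoly (k + 1) _ -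
          wordPoly (k + 1) v).eval x| ≤ δ}))]
    calc _ = ∑ e, ∑ f, ∑ u : Fin k → Bool, ∑ v : Fin k → Bool,
            volume (I ∩ {x | |(wordPoly (k + 1) (Fin.cons e u : Fin (k + 1) → Bool) -
              wordPoly (k + 1) (Fin.cons f v : Fin (k + 1) → Bool)).eval x| ≤ δ}) := by
          refine Finset.sum_congr rfl fun e _ => ?_
          rw [Finset.sum_comm]
      _ ≤ ∑ e : Bool, ∑ f : Bool,
            if e = f then ENNReal.ofReal (2 ^ k + k * K * 4 ^ k * (2 * δ) / 2)
            else ENNReal.ofReal (4 ^ k * (K * δ)) :=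
          Finset.sum_le_sum fun e _ => Finset.sum_le_sum fun f _ => hcomm e f
      _ = ENNReal.ofReal (2 ^ (k + 1) + (k + 1 : ℕ) * K * 4 ^ (k + 1) * δ / 2) := by
          simp only [Fintype.sum_bool, if_true, reduceCtorEq, if_false]
          rw [← ENNReal.ofReal_add (by positivity) (by positivity),
            ← ENNReal.ofReal_add (by positivity) (by positivity),
            ← ENNReal.ofReal_add (by positivity) (by positivity)]
          congr 1
          push_cast
          ring

open Classical in
/-- Pairs of words of length `k` whose polynomials are within `4 / 2 ^ k` of each other at `x`. -/
noncomputable def closePairs (k : ℕ) (x : ℝ) : Finset ((Fin k → Bool) × (Fin k → Bool)) :=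
  Finset.univ.filter fun p => |(wordPoly k p.1 - wordPoly k p.2).eval x| ≤ 4 / 2 ^ k

lemma card_closePairs_eq (k : ℕ) (x : ℝ) :
    ((closePairs k x).card : ENNReal) = ∑ u, ∑ v,
      {x | |(wordPoly k u - wordPoly k v).eval x| ≤ 4 / 2 ^ k}.indicator (fun _ => 1) x := by
  classical
  rw [closePairs, Finset.card_filter, ← Fintype.sum_prod_type']
  push_cast
  refine Finset.sum_congr rfl fun p _ => ?_
  simp [Set.indicator_apply]

lemma ae_eventually_card_closePairs_lt :
    ∀ᵐ x ∂volume.restrict (Set.Icc (0.5 : ℝ) 0.668), ∀ᶠ k in atTop,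
      ((closePairs k x).card : ℝ) < 2 ^ k * (k + 1) ^ 3 := by
  obtain ⟨K, hK, hT⟩ := transversal_Icc
  set I := Set.Icc (0.5 : ℝ) 0.668
  have hvol : volume I ≤ 1 := by
    rw [Real.volume_Icc, ← ENNReal.ofReal_one]
    exact ENNReal.ofReal_le_ofReal (by norm_num)
  have hI : ∀ x ∈ I, 1 / 2 ≤ x := fun x hx => by have := hx.1; norm_num at this ⊢; linarith
  have hmeas : ∀ (k : ℕ) (u v : Fin k → Bool),
      MeasurableSet {x | |(wordPoly k u - wordPoly k v).eval x| ≤ 4 / 2 ^ k} := fun k u v =>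
    (isClosed_le (wordPoly k u - wordPoly k v).continuous.abs continuous_const).measurableSet
  have hint : ∀ k, ∫⁻ x in I, ((closePairs k x).card : ENNReal) ≤
      ENNReal.ofReal (2 ^ k * (1 + 2 * k * K)) := by
    intro k
    simp_rw [card_closePairs_eq]
    rw [lintegral_finsetSum _ fun u _ => Finset.measurable_sum _ fun v _ =>
      measurable_const.indicator (hmeas k u v)]
    simp_rw [lintegral_finsetSum Finset.univ fun v _ =>
      measurable_const.indicator (hmeas k _ v), lintegral_indicator_const (hmeas k _ _),
      Measure.restrict_apply (hmeas k _ _), one_mul, Set.inter_comm _ I]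
    refine (sum_volume_close_le hI hvol hK hT k (4 / 2 ^ k) (by positivity)).trans
      (ENNReal.ofReal_le_ofReal (le_of_eq ?_))
    rw [show (4 : ℝ) ^ k = 2 ^ k * 2 ^ k by rw [← mul_pow]; norm_num]
    field_simp
    ring
  have hmarkov : ∀ k : ℕ, volume.restrict I
      {x | ENNReal.ofReal (2 ^ k * (k + 1) ^ 3) ≤ ((closePairs k x).card : ENNReal)} ≤
      ENNReal.ofReal ((1 + 2 * K) * (1 / ((k : ℝ) + 1) ^ 2)) := by
    intro k
    have hm : Measurable fun x => ((closePairs k x).card : ENNReal) := by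
      simp_rw [card_closePairs_eq]
      exact Finset.measurable_sum _ fun u _ => Finset.measurable_sum _ fun v _ =>
        measurable_const.indicator (hmeas k u v)
    have hpos : (0 : ℝ) < 2 ^ k * (k + 1) ^ 3 := by positivity
    refine (meas_ge_le_lintegral_div hm.aemeasurable (by simpa using hpos)
      ENNReal.ofReal_ne_top).trans ?_
    refine (ENNReal.div_le_div_right (hint k) _).trans ?_
    rw [← ENNReal.ofReal_div_of_pos hpos]
    refine ENNReal.ofReal_le_ofReal ?_
    rw [div_le_iff₀ hpos]
    have : (1 + 2 * K) * (1 / ((k : ℝ) + 1) ^ 2) * (2 ^ k * (k + 1) ^ 3) =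
        2 ^ k * ((1 + 2 * K) * (k + 1)) := by field_simp
    rw [this]
    gcongr
    nlinarith [(Nat.cast_nonneg k : (0 : ℝ) ≤ k)]
  have hsum : ∑' k : ℕ, volume.restrict I
      {x | ENNReal.ofReal (2 ^ k * (k + 1) ^ 3) ≤ ((closePairs k x).card : ENNReal)} ≠ ⊤ := by
    refine ne_top_of_le_ne_top ?_ (ENNReal.tsum_le_tsum hmarkov)
    have hs : Summable fun k : ℕ => (1 + 2 * K) * (1 / ((k : ℝ) + 1) ^ 2) := by
      refine Summable.mul_left _ ?_
      have := (summable_nat_add_iff 1).2 (Real.summable_one_div_nat_pow.2 (by norm_num : 1 < 2))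
      simpa using this
    exact hs.tsum_ofReal_ne_top
  filter_upwards [ae_eventually_notMem hsum] with x hx
  filter_upwards [hx] with k hk
  simp only [not_le] at hk
  rw [← ENNReal.ofReal_natCast, ENNReal.ofReal_lt_ofReal_iff (by positivity)] at hk
  exact hk

lemma card_sq_le_card_image_mul {α β : Type*} [Fintype α] [DecidableEq α] [DecidableEq β]
    (f : α → β) :
    Fintype.card α ^ 2 ≤ (Finset.univ.image f).card *
      (Finset.univ.filter fun p : α × α => f p.1 = f p.2).card := by
  have h1 : Fintype.card α =
      ∑ c ∈ Finset.univ.image f, (Finset.univ.filter fun a => f a = c).card :=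
    Finset.card_eq_sum_card_image f Finset.univ
  have h2 : (Finset.univ.filter fun p : α × α => f p.1 = f p.2).card =
      ∑ c ∈ Finset.univ.image f, (Finset.univ.filter fun a => f a = c).card ^ 2 := by
    rw [Finset.card_eq_sum_card_fiberwise (f := fun p : α × α => f p.1)
      (t := Finset.univ.image f) (fun p _ => by simp)]
    refine Finset.sum_congr rfl fun c _ => ?_
    rw [sq, ← Finset.card_product]
    congr 1
    ext p
    simp only [Finset.mem_filter, Finset.mem_univ, true_and, Finset.mem_product]
    constructor
    · rintro ⟨h, h'⟩; exact ⟨h', h ▸ h'⟩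
    · rintro ⟨h, h'⟩; exact ⟨h.trans h'.symm, h⟩
  rw [h1, h2]
  exact sq_sum_le_card_mul_sum_sq

lemma le_card_image_floor {k : ℕ} {x δ : ℝ} (hx : x ∈ Set.Icc (0.5 : ℝ) 0.668) (hδ : 0 < δ)
    (hδk : δ ≤ (1 / 2) ^ k) (h : ((closePairs k x).card : ℝ) < 2 ^ k * (k + 1) ^ 3) :
    (2 : ℝ) ^ k / (k + 1) ^ 3 ≤ (Finset.univ.image fun u : Fin k → Bool =>
      ⌊(1 - x) * (wordPoly k u).eval x / δ⌋).card := by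
  classical
  set f := fun u : Fin k → Bool => ⌊(1 - x) * (wordPoly k u).eval x / δ⌋
  have h1x : (0.332 : ℝ) ≤ 1 - x := by have := hx.2; norm_num at this ⊢; linarith
  have hsub : (Finset.univ.filter fun p : (Fin k → Bool) × (Fin k → Bool) => f p.1 = f p.2) ⊆
      closePairs k x := by
    intro p hp
    simp only [Finset.mem_filter, Finset.mem_univ, true_and, closePairs] at hp ⊢
    have := Int.abs_sub_lt_one_of_floor_eq_floor hp
    rw [← sub_div, ← mul_sub, abs_div, abs_mul, abs_of_pos hδ, div_lt_one hδ,
      abs_of_pos (by linarith : 0 < 1 - x)] at this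
    rw [Polynomial.eval_sub]
    set t := |(wordPoly k p.1).eval x - (wordPoly k p.2).eval x|
    have ht : 0.332 * t ≤ (1 - x) * t := by gcongr
    rw [one_div_pow] at hδk
    rw [div_eq_mul_one_div]
    linarith
  have hcard := card_sq_le_card_image_mul f
  rw [Fintype.card_fun, Fintype.card_bool, Fintype.card_fin] at hcard
  have hcard' : ((2 : ℝ) ^ k) ^ 2 ≤ (Finset.univ.image f).card * (2 ^ k * (k + 1) ^ 3) := by
    calc ((2 : ℝ) ^ k) ^ 2 ≤ (Finset.univ.image f).card *
          (Finset.univ.filter fun p : (Fin k → Bool) × (Fin k → Bool) => f p.1 = f p.2).card := by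
          exact_mod_cast hcard
      _ ≤ (Finset.univ.image f).card * (closePairs k x).card := by
          gcongr
      _ ≤ _ := by gcongr
  rw [div_le_iff₀ (by positivity)]
  have h2 : (0 : ℝ) < 2 ^ k := by positivity
  refine le_of_mul_le_mul_left ?_ h2
  nlinarith

lemma meshCount_eq_ncard_image (d : ℕ) {δ : ℝ} (hδ : 0 < δ) (E : Set (Fin d → ℝ)) :
    meshCount d δ E = ((fun (x : Fin d → ℝ) i => ⌊x i / δ⌋) '' E).ncard := by
  rw [meshCount]
  congr 1
  ext a
  simp only [Set.mem_ofPred_eq, Set.mem_image, funext_iff, Int.floor_eq_iff, le_div_iff₀ hδ,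
    div_lt_iff₀ hδ]

/-- The pointwise form of `F = S₀(F) ∪ S₁(F) ∪ C`. -/
def IsCondensation (lam : ℝ) (F : Set (Fin 2 → ℝ)) : Prop :=
  ∀ x : Fin 2 → ℝ, x ∈ F ↔
    (∃ y ∈ F, ∃ e : Bool, x 0 = lam * y 0 + digit e * (1 - lam) ∧ x 1 = lam * y 1) ∨
      (x 0 = 0 ∧ x 1 ∈ Set.Icc (0 : ℝ) 1)

lemma isCondensation_of_eq {lam : ℝ} {F : Set (Fin 2 → ℝ)}
    (h : F = (fun x : Fin 2 → ℝ => lam • x) '' F ∪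
      (fun x : Fin 2 → ℝ => lam • x + fun j => if j = 0 then 1 - lam else 0) '' F ∪
      {x : Fin 2 → ℝ | x 0 = 0 ∧ x 1 ∈ Set.Icc (0 : ℝ) 1}) : IsCondensation lam F := by
  intro x
  conv_lhs => rw [h]
  rw [Set.mem_union, Set.mem_union]
  refine or_congr ?_ Iff.rfl
  simp only [Set.mem_image, funext_iff, Fin.forall_fin_two, Pi.smul_apply, Pi.add_apply,
    smul_eq_mul, if_true, zero_ne_one, if_false, add_zero, Bool.exists_bool, digit, cond_false,
    cond_true, Int.cast_zero, Int.cast_one, zero_mul, one_mul, and_or_left, exists_or, eq_comm]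

section Condensation

variable {lam : ℝ} {F : Set (Fin 2 → ℝ)}

lemma IsCondensation.mem_Icc (hF : IsCondensation lam F) (h0 : 0 < lam) (h1 : lam < 1)
    (hne : F.Nonempty) (hc : IsCompact F) {x : Fin 2 → ℝ} (hx : x ∈ F) (i : Fin 2) :
    x i ∈ Set.Icc (0 : ℝ) 1 := by
  have hcont : ContinuousOn (fun x : Fin 2 → ℝ => x i) F := (continuous_apply i).continuousOn
  have hstep : ∀ y ∈ F, (∃ z ∈ F, lam * z i ≤ y i ∧ y i ≤ lam * z i + (1 - lam)) ∨
      y i ∈ Set.Icc (0 : ℝ) 1 := by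
    intro y hy
    rcases (hF y).1 hy with ⟨z, hz, e, hz0, hz1⟩ | ⟨hy0, hy1⟩
    · refine Or.inl ⟨z, hz, ?_⟩
      fin_cases i
      · simp only [Fin.zero_eta, hz0]
        cases e <;> simp [digit] <;> linarith
      · simp only [Fin.mk_one, hz1]
        constructor <;> linarith
    · right
      fin_cases i
      · simp [hy0]
      · exact hy1
  constructor
  · obtain ⟨y, hy, hmin⟩ := hc.exists_isMinOn hne hcont
    refine le_trans ?_ (hmin hx)
    rcases hstep y hy with ⟨z, hz, hz1, -⟩ | h
    · have h2 : y i ≤ z i := hmin hz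
      have := mul_le_mul_of_nonneg_left h2 h0.le
      show 0 ≤ y i
      nlinarith
    · exact h.1
  · obtain ⟨y, hy, hmax⟩ := hc.exists_isMaxOn hne hcont
    refine le_trans (hmax hx) ?_
    rcases hstep y hy with ⟨z, hz, -, hz1⟩ | h
    · have h2 : z i ≤ y i := hmax hz
      have := mul_le_mul_of_nonneg_left h2 h0.le
      show y i ≤ 1
      nlinarith
    · exact h.2

lemma IsCondensation.segment_mem (hF : IsCondensation lam F) (h0 : 0 < lam) (k : ℕ) :
    ∀ (u : Fin k → Bool) (y : ℝ), 0 ≤ y → y ≤ lam ^ k →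
      ![(1 - lam) * (wordPoly k u).eval lam, y] ∈ F := by
  induction k with
  | zero =>
    intro u y hy hy1
    refine (hF _).2 (Or.inr ⟨by simp [wordPoly], ?_⟩)
    simpa using ⟨hy, by simpa using hy1⟩
  | succ k ih =>
    intro u y hy hy1
    refine (hF _).2 (Or.inl ⟨_, ih (Fin.tail u) (y / lam) (by positivity) ?_, u 0, ?_, ?_⟩)
    · rw [div_le_iff₀ h0]; rwa [pow_succ] at hy1
    · simp [wordPoly]; ring
    · simp; field_simp

lemma IsCondensation.cover (hF : IsCondensation lam F) (h0 : 0 < lam) (h1 : lam < 1)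
    (hne : F.Nonempty) (hc : IsCompact F) (k : ℕ) : ∀ x ∈ F,
    (∃ j < k, ∃ u : Fin j → Bool, x 0 = (1 - lam) * (wordPoly j u).eval lam ∧
      x 1 ∈ Set.Icc 0 (lam ^ j)) ∨ (x 0 ∈ Set.Icc (0 : ℝ) 1 ∧ x 1 ∈ Set.Icc 0 (lam ^ k)) := by
  induction k with
  | zero =>
    intro x hx
    exact Or.inr ⟨hF.mem_Icc h0 h1 hne hc hx 0, by simpa using hF.mem_Icc h0 h1 hne hc hx 1⟩
  | succ k ih =>
    intro x hx
    have h01 := hF.mem_Icc h0 h1 hne hc hx 0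
    rcases (hF x).1 hx with ⟨y, hy, e, he0, he1⟩ | ⟨hx0, hx1⟩
    · have hscale : ∀ j, y 1 ∈ Set.Icc 0 (lam ^ j) → x 1 ∈ Set.Icc 0 (lam ^ (j + 1)) := by
        rintro j ⟨ha, hb⟩
        rw [he1, pow_succ']
        exact ⟨by positivity, by gcongr⟩
      rcases ih y hy with ⟨j, hj, u, hu0, hu1⟩ | ⟨-, hy1⟩
      · refine Or.inl ⟨j + 1, by omega, Fin.cons e u, ?_, hscale j hu1⟩
        rw [he0, hu0, wordPoly_cons]
        simp
        ring
      · exact Or.inr ⟨h01, hscale k hy1⟩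
    · exact Or.inl ⟨0, by omega, Fin.elim0, by simp [wordPoly, hx0], by simpa using hx1⟩

lemma card_Icc_floor_le {y : ℝ} (hy : 0 ≤ y) : ((Finset.Icc 0 ⌊y⌋).card : ℝ) ≤ y + 1 := by
  have h : (0 : ℤ) ≤ ⌊y⌋ := Int.floor_nonneg.2 hy
  rw [Int.card_Icc, sub_zero, ← Int.cast_natCast, Int.toNat_of_nonneg (by omega)]
  push_cast
  linarith [Int.floor_le y]

lemma floor_mem_Icc {y L δ : ℝ} (hδ : 0 < δ) (hy : y ∈ Set.Icc 0 L) :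
    ⌊y / δ⌋ ∈ Finset.Icc 0 ⌊L / δ⌋ :=
  Finset.mem_Icc.2 ⟨Int.floor_nonneg.2 (div_nonneg hy.1 hδ.le),
    Int.floor_le_floor (div_le_div_of_nonneg_right hy.2 hδ.le)⟩

lemma IsCondensation.exists_cells_superset (hF : IsCondensation lam F) (h0 : 0 < lam)
    (h1 : lam < 1) (hne : F.Nonempty) (hc : IsCompact F) {δ : ℝ} (hδ : 0 < δ) (k : ℕ) :
    ∃ T : Finset (Fin 2 → ℤ), ((fun (x : Fin 2 → ℝ) i => ⌊x i / δ⌋) '' F) ⊆ T ∧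
      (T.card : ℝ) ≤ ∑ j ∈ Finset.range k, 2 ^ j * (lam ^ j / δ + 1) +
        (1 / δ + 1) * (lam ^ k / δ + 1) := by
  classical
  refine ⟨((Finset.range k).biUnion fun j => Finset.univ.biUnion fun u : Fin j → Bool =>
      (Finset.Icc 0 ⌊lam ^ j / δ⌋).image fun b => ![⌊(1 - lam) * (wordPoly j u).eval lam / δ⌋, b]) ∪
      (Finset.Icc 0 ⌊1 / δ⌋ ×ˢ Finset.Icc 0 ⌊lam ^ k / δ⌋).image fun p => ![p.1, p.2], ?_, ?_⟩
  · rintro _ ⟨x, hx, rfl⟩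
    rw [Finset.mem_coe, Finset.mem_union]
    rcases hF.cover h0 h1 hne hc k x hx with ⟨j, hj, u, hu0, hu1⟩ | ⟨hx0, hx1⟩
    · left
      simp only [Finset.mem_biUnion, Finset.mem_range, Finset.mem_univ, true_and, Finset.mem_image]
      refine ⟨j, hj, u, ⌊x 1 / δ⌋, floor_mem_Icc hδ hu1, ?_⟩
      ext i
      fin_cases i <;> simp [hu0]
    · right
      simp only [Finset.mem_image, Finset.mem_product]
      refine ⟨(⌊x 0 / δ⌋, ⌊x 1 / δ⌋), ⟨floor_mem_Icc hδ hx0, floor_mem_Icc hδ hx1⟩, ?_⟩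
      ext i
      fin_cases i <;> simp
  · refine (Nat.cast_le.2 (Finset.card_union_le _ _)).trans ?_
    rw [Nat.cast_add]
    refine add_le_add ?_ ?_
    · refine (Nat.cast_le.2 Finset.card_biUnion_le).trans ?_
      rw [Nat.cast_sum]
      refine Finset.sum_le_sum fun j _ => (Nat.cast_le.2 Finset.card_biUnion_le).trans ?_
      rw [Nat.cast_sum]
      calc _ ≤ ∑ _u : Fin j → Bool, (lam ^ j / δ + 1) := by
            refine Finset.sum_le_sum fun u _ => (Nat.cast_le.2 Finset.card_image_le).trans ?_
            exact card_Icc_floor_le (by positivity)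
        _ = _ := by simp; ring
    · refine (Nat.cast_le.2 Finset.card_image_le).trans ?_
      rw [Finset.card_product, Nat.cast_mul]
      exact mul_le_mul (card_Icc_floor_le (by positivity)) (card_Icc_floor_le (by positivity))
        (by positivity) (by positivity)

lemma IsCondensation.meshCount_le (hF : IsCondensation lam F) (h0 : 1 / 2 < lam)
    (h1 : lam < 1) (hne : F.Nonempty) (hc : IsCompact F) {δ : ℝ} {k : ℕ}
    (hk : (1 / 2) ^ (k + 1) < δ) : (meshCount 2 δ F : ℝ) ≤ (4 * lam) ^ k * (2 * k + 10) := by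
  have hδ : 0 < δ := lt_trans (by positivity) hk
  have hlam : 0 < lam := by linarith
  obtain ⟨T, hT, hcard⟩ := hF.exists_cells_superset hlam h1 hne hc hδ k
  rw [meshCount_eq_ncard_image 2 hδ]
  have h2 := Set.ncard_le_ncard hT T.finite_toSet
  rw [Set.ncard_coe_finset] at h2
  refine (Nat.cast_le.2 h2).trans (hcard.trans ?_)
  have hinv : 1 / δ ≤ 2 * 2 ^ k := by
    rw [div_le_iff₀ hδ]
    have h3 : (1 / 2 : ℝ) ^ (k + 1) * (2 * 2 ^ k) = 1 := by
      rw [← pow_succ', ← mul_pow]; norm_num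
    have h4 : (1 / 2 : ℝ) ^ (k + 1) * (2 * 2 ^ k) ≤ δ * (2 * 2 ^ k) := by gcongr
    linarith
  have hE : (4 * lam) ^ k = 2 ^ k * (2 * lam) ^ k := by rw [← mul_pow]; ring
  set E := (2 * lam) ^ k
  have hE1 : 1 ≤ E := one_le_pow₀ (by linarith)
  have hB1 : (1 : ℝ) ≤ 2 ^ k := one_le_pow₀ (by norm_num)
  set B : ℝ := 2 ^ k
  have hsum : ∑ j ∈ Finset.range k, 2 ^ j * (lam ^ j / δ + 1) ≤ k * (E * (2 * B)) + B := by
    simp_rw [mul_add, mul_one, Finset.sum_add_distrib]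
    refine add_le_add ?_ ?_
    · calc _ ≤ ∑ _j ∈ Finset.range k, E * (2 * B) := by
            refine Finset.sum_le_sum fun j hj => ?_
            rw [div_eq_mul_one_div, ← mul_assoc, ← mul_pow]
            gcongr
            exact pow_le_pow_right₀ (by linarith) (Finset.mem_range.1 hj).le
        _ = _ := by simp
    · have := geom_sum_eq (by norm_num : (2 : ℝ) ≠ 1) k
      rw [this]
      norm_num
      exact le_of_lt (by linarith)
  have hlast : (1 / δ + 1) * (lam ^ k / δ + 1) ≤ (2 * B + 1) * (2 * E + 1) := by
    have : lam ^ k / δ ≤ 2 * E := by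
      have e : E = 2 ^ k * lam ^ k := mul_pow _ _ _
      rw [div_eq_mul_one_div, e]
      calc lam ^ k * (1 / δ) ≤ lam ^ k * (2 * 2 ^ k) := by gcongr
        _ = _ := by ring
    gcongr
  rw [hE]
  nlinarith [mul_nonneg (sub_nonneg.2 hE1) (sub_nonneg.2 hB1)]

lemma IsCondensation.le_meshCount (hF : IsCondensation lam F) (hlam : lam ∈ Set.Icc (0.5 : ℝ) 0.668)
    (hne : F.Nonempty) (hc : IsCompact F) {δ : ℝ} {k : ℕ} (hδ : 0 < δ) (hk : δ ≤ (1 / 2) ^ k)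
    (h : ((closePairs k lam).card : ℝ) < 2 ^ k * (k + 1) ^ 3) :
    (4 * lam) ^ k / (k + 1) ^ 3 ≤ meshCount 2 δ F := by
  classical
  have h0 : 0 < lam := lt_of_lt_of_le (by norm_num) hlam.1
  have h1 : lam < 1 := lt_of_le_of_lt hlam.2 (by norm_num)
  have himage := le_card_image_floor hlam hδ hk h
  set S := Finset.univ.image fun u : Fin k → Bool => ⌊(1 - lam) * (wordPoly k u).eval lam / δ⌋
  obtain ⟨T, hT, -⟩ := hF.exists_cells_superset h0 h1 hne hc hδ 0
  have hL : 0 ≤ ⌊lam ^ k / δ⌋ := Int.floor_nonneg.2 (by positivity)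
  have hsub : (((S ×ˢ Finset.Icc 0 ⌊lam ^ k / δ⌋).image fun p => ![p.1, p.2] :
      Finset (Fin 2 → ℤ)) : Set (Fin 2 → ℤ)) ⊆ (fun (x : Fin 2 → ℝ) i => ⌊x i / δ⌋) '' F := by
    intro a ha
    simp only [Finset.coe_image, Set.mem_image, Finset.mem_coe, Finset.mem_product,
      Finset.mem_Icc] at ha
    obtain ⟨⟨c, b⟩, ⟨hcS, hb0, hb1⟩, rfl⟩ := ha
    obtain ⟨u, -, rfl⟩ := Finset.mem_image.1 hcS
    refine ⟨_, hF.segment_mem h0 k u (b * δ) ?_ ?_, ?_⟩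
    · have : (0 : ℝ) ≤ b := by exact_mod_cast hb0
      positivity
    · rw [← le_div_iff₀ hδ]
      exact Int.le_floor.1 hb1
    · ext i
      fin_cases i
      · simp
      · simp [hδ.ne']
  have hcard := Set.ncard_le_ncard hsub (T.finite_toSet.subset hT)
  rw [Set.ncard_coe_finset, Finset.card_image_of_injective _ (fun p q hpq => by
    have e0 := congrFun hpq 0
    have e1 := congrFun hpq 1
    exact Prod.ext (by simpa using e0) (by simpa using e1)), Finset.card_product,
    ← meshCount_eq_ncard_image 2 hδ] at hcard
  have hcol : lam ^ k * 2 ^ k ≤ ((Finset.Icc 0 ⌊lam ^ k / δ⌋).card : ℝ) := by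
    rw [Int.card_Icc, sub_zero, ← Int.cast_natCast, Int.toNat_of_nonneg (by omega)]
    push_cast
    have h3 : lam ^ k * 2 ^ k ≤ lam ^ k / δ := by
      rw [le_div_iff₀ hδ]
      calc lam ^ k * 2 ^ k * δ ≤ lam ^ k * 2 ^ k * (1 / 2) ^ k := by gcongr
        _ = lam ^ k := by rw [mul_assoc, ← mul_pow]; norm_num
    linarith [Int.lt_floor_add_one (lam ^ k / δ)]
  calc (4 * lam) ^ k / (k + 1) ^ 3 = 2 ^ k / (k + 1) ^ 3 * (lam ^ k * 2 ^ k) := by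
        rw [mul_pow, show (4 : ℝ) ^ k = 2 ^ k * 2 ^ k by rw [← mul_pow]; norm_num]
        ring
    _ ≤ S.card * ((Finset.Icc 0 ⌊lam ^ k / δ⌋).card : ℝ) := by gcongr
    _ ≤ meshCount 2 δ F := by exact_mod_cast hcard

end Condensation

lemma tendsto_log_div_neg_log {N : ℝ → ℕ} {q : ℝ} (hq : 0 < q)
    (hN : ∀ᶠ k : ℕ in atTop, ∀ δ : ℝ, 0 < δ → δ ≤ (1 / 2) ^ k → (1 / 2) ^ (k + 1) < δ →
      q ^ k / (k + 1) ^ 3 ≤ N δ ∧ (N δ : ℝ) ≤ q ^ k * (2 * k + 10)) :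
    Tendsto (fun δ => Real.log (N δ) / (-Real.log δ)) (nhdsWithin 0 (Set.Ioi 0))
      (nhds (Real.log q / Real.log 2)) := by
  have hl2 : 0 < Real.log 2 := Real.log_pos (by norm_num)
  have hT : Tendsto (fun δ => -Real.log δ) (nhdsWithin 0 (Set.Ioi 0)) atTop :=
    tendsto_neg_atBot_atTop.comp Real.tendsto_log_nhdsGT_zero
  set κ : ℝ → ℕ := fun δ => ⌊(Real.log 2)⁻¹ * (-Real.log δ)⌋₊ with hκ
  have hκtop : Tendsto κ (nhdsWithin 0 (Set.Ioi 0)) atTop :=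
    tendsto_nat_floor_atTop.comp (hT.const_mul_atTop (inv_pos.2 hl2))
  have hκT : Tendsto (fun δ => (κ δ : ℝ) / (-Real.log δ)) (nhdsWithin 0 (Set.Ioi 0))
      (nhds (Real.log 2)⁻¹) :=
    (tendsto_nat_floor_mul_div_atTop (R := ℝ) (inv_nonneg.2 hl2.le)).comp hT
  have hlog : Tendsto (fun δ => Real.log (2 * κ δ + 10) / (-Real.log δ))
      (nhdsWithin 0 (Set.Ioi 0)) (nhds 0) := by
    have h1 : Tendsto (fun δ => 2 * (κ δ : ℝ) + 10) (nhdsWithin 0 (Set.Ioi 0)) atTop :=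
      tendsto_atTop_add_const_right _ _
        ((tendsto_natCast_atTop_atTop.comp hκtop).const_mul_atTop (by norm_num))
    have h2 := (Real.isLittleO_log_id_atTop.comp_tendsto h1).tendsto_div_nhds_zero
    have h3 : Tendsto (fun δ => (2 * (κ δ : ℝ) + 10) / (-Real.log δ)) (nhdsWithin 0 (Set.Ioi 0))
        (nhds (2 * (Real.log 2)⁻¹ + 0)) := by
      have := (hκT.const_mul 2).add (hT.const_div_atTop 10)
      refine this.congr fun δ => ?_
      ring
    have h4 := h2.mul h3
    rw [zero_mul] at h4
    refine h4.congr' ?_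
    filter_upwards [h1.eventually_gt_atTop 0] with δ hδ
    simp only [Function.comp_apply, id_eq]
    field_simp
  have hmain : Tendsto (fun δ => (κ δ : ℝ) / (-Real.log δ) * Real.log q)
      (nhdsWithin 0 (Set.Ioi 0)) (nhds (Real.log q / Real.log 2)) := by
    have := hκT.mul_const (Real.log q)
    rwa [inv_mul_eq_div] at this
  have hlow := hmain.sub (hlog.const_mul 3)
  have hupp := hmain.add (hlog.const_mul 3)
  rw [mul_zero, sub_zero] at hlow
  rw [mul_zero, add_zero] at hupp
  have hbound : ∀ᶠ δ in nhdsWithin (0 : ℝ) (Set.Ioi 0),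
      |Real.log (N δ) - κ δ * Real.log q| ≤ 3 * Real.log (2 * κ δ + 10) := by
    filter_upwards [hκtop.eventually hN, self_mem_nhdsWithin, hT.eventually_gt_atTop 0]
      with δ hδN hδ hδT
    have hδ' : (0 : ℝ) < δ := hδ
    have hle : δ ≤ (1 / 2) ^ κ δ := by
      rw [← Real.log_le_log_iff hδ' (by positivity), Real.log_pow, one_div, Real.log_inv]
      have := Nat.floor_le (a := (Real.log 2)⁻¹ * (-Real.log δ)) (by positivity)
      rw [inv_mul_eq_div, le_div_iff₀ hl2, ← inv_mul_eq_div] at this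
      simp only [hκ]
      linarith
    have hlt : (1 / 2) ^ (κ δ + 1) < δ := by
      rw [← Real.log_lt_log_iff (by positivity) hδ', Real.log_pow, one_div, Real.log_inv]
      have := Nat.lt_floor_add_one ((Real.log 2)⁻¹ * (-Real.log δ))
      rw [inv_mul_eq_div, div_lt_iff₀ hl2, ← inv_mul_eq_div] at this
      simp only [hκ]
      push_cast
      linarith
    obtain ⟨ha, hb⟩ := hδN δ hδ' hle hlt
    have hNpos : (0 : ℝ) < N δ := lt_of_lt_of_le (by positivity) ha
    have ha' := Real.log_le_log (by positivity) ha
    have hb' := Real.log_le_log hNpos hb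
    rw [Real.log_div (by positivity) (by positivity), Real.log_pow, Real.log_pow] at ha'
    rw [Real.log_mul (by positivity) (by positivity), Real.log_pow] at hb'
    have hmono : Real.log ((κ δ : ℝ) + 1) ≤ Real.log (2 * κ δ + 10) :=
      Real.log_le_log (by positivity) (by linarith [(Nat.cast_nonneg (κ δ) : (0 : ℝ) ≤ κ δ)])
    have hpos : 0 ≤ Real.log (2 * (κ δ : ℝ) + 10) :=
      Real.log_nonneg (by linarith [(Nat.cast_nonneg (κ δ) : (0 : ℝ) ≤ κ δ)])
    push_cast at ha'
    rw [abs_le]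
    constructor <;> linarith
  refine tendsto_of_tendsto_of_tendsto_of_le_of_le' hlow hupp ?_ ?_
  · filter_upwards [hbound, hT.eventually_gt_atTop 0] with δ h hδT
    rw [abs_le] at h
    rw [div_mul_eq_mul_div, mul_div_assoc', ← sub_div]
    gcongr
    linarith
  · filter_upwards [hbound, hT.eventually_gt_atTop 0] with δ h hδT
    rw [abs_le] at h
    rw [div_mul_eq_mul_div, mul_div_assoc', ← add_div]
    gcongr
    linarith

/-- For Lebesgue almost every `λ ∈ (1/2, 0.668)`, the box dimension of the inhomogeneous
attractor `F_C^λ` (the unique nonempty compact set with `F = S₀(F) ∪ S₁(F) ∪ C`, where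
`S₀(x) = λx`, `S₁(x) = λx + (1-λ,0)` and `C = {0} × [0,1]`) exists and equals
`log(4λ)/log 2`. -/
theorem generic_bernoulli_inhomogeneous_box_dim :
    ∀ᵐ lam ∂(volume.restrict (Set.Ioo (1 / 2 : ℝ) 0.668)),
      ∀ F : Set (Fin 2 → ℝ), F.Nonempty → IsCompact F →
        F = (fun x : Fin 2 → ℝ => lam • x) '' F ∪
            (fun x : Fin 2 → ℝ => lam • x + fun j => if j = 0 then 1 - lam else 0) '' F ∪
            {x : Fin 2 → ℝ | x 0 = 0 ∧ x 1 ∈ Set.Icc (0 : ℝ) 1} →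
        upperBoxDim 2 F = Real.log (4 * lam) / Real.log 2 ∧
        lowerBoxDim 2 F = Real.log (4 * lam) / Real.log 2 := by
  have hsub : Set.Ioo (1 / 2 : ℝ) 0.668 ⊆ Set.Icc 0.5 0.668 := fun x hx =>
    ⟨by have := hx.1; norm_num at this ⊢; linarith, hx.2.le⟩
  filter_upwards [ae_restrict_of_ae_restrict_of_subset hsub ae_eventually_card_closePairs_lt,
    ae_restrict_mem measurableSet_Ioo] with lam hpairs hlam F hne hc hF
  have hF' := isCondensation_of_eq hF
  have hlim : Tendsto (fun δ => Real.log (meshCount 2 δ F) / (-Real.log δ))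
      (nhdsWithin 0 (Set.Ioi 0)) (nhds (Real.log (4 * lam) / Real.log 2)) := by
    refine tendsto_log_div_neg_log (by linarith [hlam.1]) ?_
    filter_upwards [hpairs] with k hk δ hδ hle hlt
    exact ⟨hF'.le_meshCount (hsub hlam) hne hc hδ hle hk,
      hF'.meshCount_le hlam.1 (hlam.2.trans (by norm_num)) hne hc hlt⟩
  exact ⟨hlim.limsup_eq, hlim.liminf_eq⟩
end

section
/- For Lebesgue almost every λ ∈ (1/2, 0.668), the inequality 2^{n−1} ≤ #{a ∈ A_n(λ) : |a−b| > 1/(n² 2^n) for all b ∈ A_n(λ) with b ≠ a} holds for all but finitely many n ∈ ℕ. -/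
open Filter MeasureTheory

/-- `A_n(λ) = {(1-λ) Σ_{k=1}^n i_k λ^{k-1} : (i_k) ∈ {0,1}^n} ⊆ ℝ`. -/
def Aset (lam : ℝ) (n : ℕ) : Set ℝ :=
  {x | ∃ i : Fin n → Fin 2, x = (1 - lam) * ∑ k : Fin n, ((i k : ℕ) : ℝ) * lam ^ (k : ℕ)}

/-- Evaluation of the polynomial with coefficient list `l` (constant term first). -/
def evalList (x : ℝ) : List ℤ → ℝ
  | [] => 0
  | b :: l => b + x * evalList x l

/-- First derivative of `evalList`. -/
def evalListDeriv (x : ℝ) : List ℤ → ℝ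
  | [] => 0
  | _ :: l => evalList x l + x * evalListDeriv x l

/-- Second derivative of `evalList`. -/
def evalListDeriv2 (x : ℝ) : List ℤ → ℝ
  | [] => 0
  | _ :: l => 2 * evalListDeriv x l + x * evalListDeriv2 x l

theorem hasDerivAt_evalList (l : List ℤ) (x : ℝ) :
    HasDerivAt (fun y => evalList y l) (evalListDeriv x l) x := by
  induction l with
  | nil => simpa [evalList, evalListDeriv] using hasDerivAt_const x (0 : ℝ)
  | cons b l ih =>
    simpa [evalList, evalListDeriv] using ((hasDerivAt_id x).mul ih).const_add (b : ℝ)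

theorem hasDerivAt_evalListDeriv (l : List ℤ) (x : ℝ) :
    HasDerivAt (fun y => evalListDeriv y l) (evalListDeriv2 x l) x := by
  induction l with
  | nil => simpa [evalListDeriv, evalListDeriv2] using hasDerivAt_const x (0 : ℝ)
  | cons b l ih =>
    have h := (hasDerivAt_evalList l x).add ((hasDerivAt_id x).mul ih)
    refine h.congr_deriv ?_
    simp only [evalListDeriv2, id_eq]; ring

/-- All coefficients lie in `{-1, 0, 1}`. -/
def IsSignList (l : List ℤ) : Prop := ∀ b ∈ l, b = -1 ∨ b = 0 ∨ b = 1

theorem IsSignList.tail {b : ℤ} {l : List ℤ} (h : IsSignList (b :: l)) : IsSignList l :=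
  fun c hc => h c (List.mem_cons_of_mem b hc)

theorem IsSignList.abs_head_le {b : ℤ} {l : List ℤ} (h : IsSignList (b :: l)) :
    |(b : ℝ)| ≤ 1 := by
  rcases h b List.mem_cons_self with rfl | rfl | rfl <;> norm_num

theorem abs_evalList_le {x : ℝ} (h0 : 0 ≤ x) (h1 : x < 1) {l : List ℤ} (hl : IsSignList l) :
    |evalList x l| ≤ 1 / (1 - x) := by
  have hx : 0 < 1 - x := by linarith
  induction l with
  | nil => simpa [evalList] using h1.le
  | cons b l ih =>
    calc |evalList x (b :: l)| ≤ |(b : ℝ)| + |x * evalList x l| := abs_add_le _ _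
      _ ≤ 1 + x * (1 / (1 - x)) := by
        rw [abs_mul, abs_of_nonneg h0]
        gcongr
        · exact hl.abs_head_le
        · exact ih hl.tail
      _ = 1 / (1 - x) := by field_simp; ring

theorem abs_evalListDeriv_le {x : ℝ} (h0 : 0 ≤ x) (h1 : x < 1) {l : List ℤ}
    (hl : IsSignList l) : |evalListDeriv x l| ≤ 1 / (1 - x) ^ 2 := by
  have hx : 0 < 1 - x := by linarith
  induction l with
  | nil => simp [evalListDeriv]; positivity
  | cons b l ih =>
    calc |evalListDeriv x (b :: l)| ≤ |evalList x l| + |x * evalListDeriv x l| := abs_add_le _ _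
      _ ≤ 1 / (1 - x) + x * (1 / (1 - x) ^ 2) := by
        rw [abs_mul, abs_of_nonneg h0]
        gcongr
        · exact abs_evalList_le h0 h1 hl.tail
        · exact ih hl.tail
      _ = 1 / (1 - x) ^ 2 := by field_simp; ring

theorem abs_evalListDeriv2_le {x : ℝ} (h0 : 0 ≤ x) (h1 : x < 1) {l : List ℤ}
    (hl : IsSignList l) : |evalListDeriv2 x l| ≤ 2 / (1 - x) ^ 3 := by
  have hx : 0 < 1 - x := by linarith
  induction l with
  | nil => simp [evalListDeriv2]; positivity
  | cons b l ih =>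
    calc |evalListDeriv2 x (b :: l)|
        ≤ |2 * evalListDeriv x l| + |x * evalListDeriv2 x l| := abs_add_le _ _
      _ ≤ 2 * (1 / (1 - x) ^ 2) + x * (2 / (1 - x) ^ 3) := by
        rw [abs_mul, abs_mul, abs_of_nonneg h0, abs_two]
        gcongr
        · exact abs_evalListDeriv_le h0 h1 hl.tail
        · exact ih hl.tail
      _ = 2 / (1 - x) ^ 3 := by field_simp; ring

/-- `∑_{i ≥ 1} |i - j| x ^ i`, computed recursively in `j`. -/
def tailBound (x : ℚ) : ℕ → ℚ
  | 0 => x / (1 - x) ^ 2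
  | j + 1 => x * (j + tailBound x j)

theorem abs_tail_le {x : ℚ} (h0 : 0 ≤ x) (h1 : x < 1) {l : List ℤ} (hl : IsSignList l)
    (j : ℕ) :
    |x * (evalList x l + x * evalListDeriv x l) - j * (x * evalList x l)|
      ≤ (tailBound x j : ℝ) := by
  have h0' : (0 : ℝ) ≤ x := by exact_mod_cast h0
  have h1' : (x : ℝ) < 1 := by exact_mod_cast h1
  have hx : (0 : ℝ) < 1 - x := by linarith
  induction j generalizing l with
  | zero =>
    have e : (x : ℝ) * (evalList x l + x * evalListDeriv x l) - (0 : ℕ) * (x * evalList x l)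
        = x * (evalList x l + x * evalListDeriv x l) := by push_cast; ring
    rw [e, abs_mul, abs_of_nonneg h0']
    calc (x : ℝ) * |evalList x l + x * evalListDeriv x l|
        ≤ x * (1 / (1 - x) + x * (1 / (1 - x) ^ 2)) := by
          gcongr
          refine (abs_add_le _ _).trans ?_
          rw [abs_mul, abs_of_nonneg h0']
          gcongr
          · exact abs_evalList_le h0' h1' hl
          · exact abs_evalListDeriv_le h0' h1' hl
      _ = (tailBound x 0 : ℝ) := by
          simp only [tailBound]; push_cast; field_simp; ring
  | succ j ih =>
    have key : ∀ (c : ℝ) (r : List ℤ), |c| ≤ 1 → IsSignList r →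
        |(x : ℝ) * (-j * c + (x * (evalList x r + x * evalListDeriv x r)
          - j * (x * evalList x r)))| ≤ (tailBound x (j + 1) : ℝ) := by
      intro c r hc hr
      rw [abs_mul, abs_of_nonneg h0']
      simp only [tailBound]; push_cast
      gcongr
      refine (abs_add_le _ _).trans ?_
      gcongr
      · rw [abs_mul, abs_neg, Nat.abs_cast]
        exact mul_le_of_le_one_right (Nat.cast_nonneg j) hc
      · exact ih hr
    cases l with
    | nil =>
      convert key 0 [] (by norm_num) hl using 2
      simp [evalList, evalListDeriv]
    | cons b r =>
      convert key b r hl.abs_head_le hl.tail using 2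
      simp only [evalList, evalListDeriv]; push_cast; ring

/-- Applies `k` to `n` once `n` is evaluated to a numeral. -/
def forceNat (n : ℕ) (k : ℕ → Bool) : Bool :=
  match n with
  | 0 => k 0
  | m + 1 => k (m + 1)

theorem forceNat_eq (n : ℕ) (k : ℕ → Bool) : forceNat n k = k n := by
  cases n <;> rfl

/-- Applies `k` to `q` once `q` is evaluated to a quotient of numerals. -/
def forceRat (q : ℚ) (k : ℚ → Bool) : Bool :=
  forceNat q.den fun d =>
    match q.num with
    | Int.ofNat n => forceNat n fun n => k (mkRat n d)
    | Int.negSucc n => forceNat n fun n => k (mkRat (Int.negSucc n) d)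

theorem forceRat_eq (q : ℚ) (k : ℚ → Bool) : forceRat q k = k q := by
  rw [forceRat, forceNat_eq]
  conv_rhs => rw [← Rat.mkRat_self q]
  rcases q.num with n | n
  · simp only [forceNat_eq, Int.ofNat_eq_natCast]
  · simp only [forceNat_eq]

/-- A branch and bound search; `A`, `B` are the rescaled values of a prefix and of `x` times its
derivative, `s`, `t` the rescaled tolerances. A return value of `true` certifies that no
continuation of the prefix keeps both quantities within their tolerances. -/
def excludes (x : ℚ) : ℕ → ℚ → ℚ → ℚ → ℚ → Bool
  | 0, _, _, _, _ => false
  | n + 1, A, B, s, t =>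
    decide (x / (1 - x) + s < |A|) ||
    (List.range 5).any (fun j => decide (tailBound x j + t + j * s < |B - j * A|)) ||
    [-1, 0, 1].all (fun b : ℤ => forceRat (A / x + b) fun A₁ => forceRat ((B - A) / x) fun B₁ =>
      forceRat (s / x) fun s₁ => forceRat ((t + s) / x) fun t₁ => excludes x n A₁ B₁ s₁ t₁)

theorem excludes_sound {x : ℚ} (h0 : 0 < x) (h1 : x < 1) {n : ℕ} {A B s t : ℚ}
    (h : excludes x n A B s t = true) {l : List ℤ} (hl : IsSignList l)
    (hs : |A + x * evalList x l| ≤ (s : ℝ)) :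
    (t : ℝ) < |B + x * (evalList x l + x * evalListDeriv x l)| := by
  have h0' : (0 : ℝ) < x := by exact_mod_cast h0
  have h1' : (x : ℝ) < 1 := by exact_mod_cast h1
  induction n generalizing A B s t l with
  | zero => simp [excludes] at h
  | succ n ih =>
    by_contra! ht
    simp only [excludes, Bool.or_eq_true, decide_eq_true_eq, List.any_eq_true,
      List.all_eq_true, forceRat_eq] at h
    rcases h with (h | ⟨j, -, h⟩) | h
    · have h' : (x : ℝ) / (1 - x) + s < |(A : ℝ)| := by exact_mod_cast h
      have h2 : |x * evalList x l| ≤ (x : ℝ) / (1 - x) := by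
        rw [abs_mul, abs_of_pos h0', div_eq_mul_one_div]
        gcongr
        exact abs_evalList_le h0'.le h1' hl
      have h3 := abs_sub (A + x * evalList x l : ℝ) (x * evalList x l)
      rw [add_sub_cancel_right] at h3
      linarith
    · have h' : (tailBound x j : ℝ) + t + j * s < |(B : ℝ) - j * A| := by exact_mod_cast h
      have h2 := abs_tail_le h0.le h1 hl j
      set G : ℝ := x * evalList x l
      set D : ℝ := x * (evalList x l + x * evalListDeriv x l)
      have h3 : |(B : ℝ) - j * A| ≤ |B + D| + j * |A + G| + |D - j * G| := by
        have e : (B : ℝ) - j * A = (B + D) - j * (A + G) - (D - j * G) := by ring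
        rw [e]
        refine (abs_sub _ _).trans (add_le_add_left ((abs_sub _ _).trans ?_) _)
        rw [abs_mul, Nat.abs_cast]
      have h4 : (j : ℝ) * |A + G| ≤ j * s := by gcongr
      linarith
    · have key : ∀ (b : ℤ) (r : List ℤ), (b = -1 ∨ b = 0 ∨ b = 1) → IsSignList r →
          |(A : ℝ) + x * (b + x * evalList x r)| ≤ s →
          |(B : ℝ) + x * (b + x * evalList x r + x * (evalList x r + x * evalListDeriv x r))|
            ≤ t → False := by
        intro b r hb hr hs ht
        have h2 := ih (h b (by simpa using hb)) hr
        push_cast at h2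
        have e1 : (A : ℝ) / x + b + x * evalList x r
            = (A + x * (b + x * evalList x r)) / x := by field_simp; ring
        have e2 : ((B : ℝ) - A) / x + x * (evalList x r + x * evalListDeriv x r)
            = ((B + x * (b + x * evalList x r + x * (evalList x r + x * evalListDeriv x r)))
              - (A + x * (b + x * evalList x r))) / x := by field_simp; ring
        rw [e1, e2, abs_div, abs_div, abs_of_pos h0', div_le_div_iff_of_pos_right h0',
          div_lt_div_iff_of_pos_right h0'] at h2
        have h3 := abs_sub
          ((B : ℝ) + x * (b + x * evalList x r + x * (evalList x r + x * evalListDeriv x r)))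
          (A + x * (b + x * evalList x r))
        linarith [h2 hs]
      cases l with
      | nil =>
        refine key 0 [] (by simp) hl ?_ ?_
        · simpa [evalList] using hs
        · simpa [evalList, evalListDeriv] using ht
      | cons b r =>
        exact key b r (hl b List.mem_cons_self) hl.tail hs ht

/-- The search certificate for the interval `[u, v]`. -/
def excludesOn (u v : ℚ) : Bool :=
  let c := (u + v) / 2
  let r := (v - u) / 2
  let e := 1 / 10 ^ 6 + 55 * r
  excludes c 16 1 0 (1 / 10 ^ 6 + e * r) (c * e)

theorem excludesOn_all :
    (excludesOn 0.5 0.567 && excludesOn 0.567 0.613 && excludesOn 0.613 0.635 &&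
    excludesOn 0.635 0.65 && excludesOn 0.65 0.66 && excludesOn 0.66 0.665 &&
    excludesOn 0.665 0.6669 && excludesOn 0.6669 0.6678 && excludesOn 0.6678 0.668) = true := by
  decide +kernel

theorem abs_evalListDeriv2_le_of_le {x : ℝ} (h0 : 0 ≤ x) (h1 : x ≤ 0.668) {l : List ℤ}
    (hl : IsSignList l) : |evalListDeriv2 x l| ≤ 55 := by
  refine (abs_evalListDeriv2_le h0 (by norm_num at h1 ⊢; linarith) hl).trans ?_
  have h2 : (0.332 : ℝ) ≤ 1 - x := by norm_num at h1 ⊢; linarith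
  have h3 : (0.332 : ℝ) ^ 3 ≤ (1 - x) ^ 3 := by gcongr
  rw [div_le_iff₀ (by positivity)]
  norm_num at h3 ⊢; linarith

theorem abs_evalListDeriv_sub_le {l : List ℤ} (hl : IsSignList l) {x y : ℝ}
    (hx : x ∈ Set.Icc (1 / 2 : ℝ) 0.668) (hy : y ∈ Set.Icc (1 / 2 : ℝ) 0.668) :
    |evalListDeriv y l - evalListDeriv x l| ≤ 55 * |y - x| :=
  (convex_Icc (1 / 2 : ℝ) 0.668).norm_image_sub_le_of_norm_hasDerivWithin_le
    (fun z _ => (hasDerivAt_evalListDeriv l z).hasDerivWithinAt)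
    (fun z hz => abs_evalListDeriv2_le_of_le (by linarith [hz.1]) hz.2 hl) hx hy

theorem IsSignList.one_cons {l : List ℤ} (hl : IsSignList l) : IsSignList (1 :: l) := by
  intro b hb
  rcases List.mem_cons.1 hb with rfl | hb
  · simp
  · exact hl b hb

theorem excludesOn_sound {u v : ℚ} (hu : 0.5 ≤ u) (hv : v ≤ 0.668)
    (h : excludesOn u v = true) {l : List ℤ} (hl : IsSignList l) {x : ℝ}
    (hxu : (u : ℝ) ≤ x) (hxv : x ≤ v) (hg : |evalList x (1 :: l)| ≤ 1 / 10 ^ 6) :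
    1 / 10 ^ 6 < |evalListDeriv x (1 :: l)| := by
  by_contra! ht
  have hu' : (1 / 2 : ℝ) ≤ u := by
    have : ((0.5 : ℚ) : ℝ) ≤ u := by exact_mod_cast hu
    norm_num at this ⊢; exact this
  have hv' : (v : ℝ) ≤ 0.668 := by
    have : (v : ℝ) ≤ ((0.668 : ℚ) : ℝ) := by exact_mod_cast hv
    norm_num at this ⊢; exact this
  simp only [excludesOn] at h
  set c : ℚ := (u + v) / 2 with hc
  set r : ℚ := (v - u) / 2 with hr
  have hc' : (c : ℝ) = (u + v) / 2 := by rw [hc]; push_cast; ring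
  have hr' : (r : ℝ) = (v - u) / 2 := by rw [hr]; push_cast; ring
  have hcI : (c : ℝ) ∈ Set.Icc (1 / 2 : ℝ) 0.668 := ⟨by linarith, by linarith⟩
  have hxI : x ∈ Set.Icc (1 / 2 : ℝ) 0.668 := ⟨by linarith, by linarith⟩
  have hcx : |(c : ℝ) - x| ≤ r := abs_le.2 ⟨by linarith, by linarith⟩
  have hc0 : (0 : ℝ) < c := by linarith [hcI.1]
  have hc1 : (c : ℝ) < 1 := by have := hcI.2; norm_num at this ⊢; linarith
  have hderiv : ∀ y ∈ segment ℝ x (c : ℝ), |evalListDeriv y (1 :: l)| ≤ 1 / 10 ^ 6 + 55 * r := by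
    intro y hy
    have hyI := (convex_Icc (1 / 2 : ℝ) 0.668).segment_subset hxI hcI hy
    have h1 := abs_evalListDeriv_sub_le hl.one_cons hxI hyI
    have h2 : |y - x| ≤ |(c : ℝ) - x| := by
      rw [segment_eq_uIcc] at hy
      exact Set.abs_sub_left_of_mem_uIcc hy
    have h3 := abs_sub_abs_le_abs_sub (evalListDeriv y (1 :: l)) (evalListDeriv x (1 :: l))
    linarith
  have hval : |evalList c (1 :: l) - evalList x (1 :: l)| ≤ (1 / 10 ^ 6 + 55 * r) * |(c : ℝ) - x| :=
    (convex_segment x (c : ℝ)).norm_image_sub_le_of_norm_hasDerivWithin_le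
      (fun z _ => (hasDerivAt_evalList (1 :: l) z).hasDerivWithinAt) hderiv
      (left_mem_segment ℝ _ _) (right_mem_segment ℝ _ _)
  have hdc := hderiv c (right_mem_segment ℝ _ _)
  have hr0 : (0 : ℝ) ≤ r := (abs_nonneg _).trans hcx
  have key := excludes_sound (by exact_mod_cast hc0) (by exact_mod_cast hc1) h hl ?_
  · have e : ((0 : ℚ) : ℝ) + c * (evalList c l + c * evalListDeriv c l)
        = c * evalListDeriv c (1 :: l) := by simp [evalListDeriv]
    rw [e, abs_mul, abs_of_pos hc0] at key
    push_cast at key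
    exact (lt_of_mul_lt_mul_left key hc0.le).not_ge hdc
  · have e : ((1 : ℚ) : ℝ) + c * evalList c l = evalList c (1 :: l) := by simp [evalList]
    rw [e]
    have h3 := abs_sub_abs_le_abs_sub (evalList c (1 :: l)) (evalList x (1 :: l))
    have h4 : (1 / 10 ^ 6 + 55 * (r : ℝ)) * |(c : ℝ) - x| ≤ (1 / 10 ^ 6 + 55 * r) * r := by gcongr
    push_cast
    linarith

/-- Transversality on `[1/2, 0.668]` for power series with coefficients in `{-1, 0, 1}`. -/
theorem transversality {l : List ℤ} (hl : IsSignList l) {x : ℝ}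
    (hx : x ∈ Set.Icc (1 / 2 : ℝ) 0.668) (hg : |evalList x (1 :: l)| ≤ 1 / 10 ^ 6) :
    1 / 10 ^ 6 < |evalListDeriv x (1 :: l)| := by
  have H := excludesOn_all
  simp only [Bool.and_eq_true] at H
  obtain ⟨⟨⟨⟨⟨⟨⟨⟨h1, h2⟩, h3⟩, h4⟩, h5⟩, h6⟩, h7⟩, h8⟩, h9⟩ := H
  by_contra hcon
  have step : ∀ u v : ℚ, 0.5 ≤ u → v ≤ 0.668 → excludesOn u v = true → (u : ℝ) ≤ x →
      (v : ℝ) < x := fun u v hu hv h hux =>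
    not_le.1 fun hxv => hcon (excludesOn_sound hu hv h hl hux hxv hg)
  have hx0 : ((0.5 : ℚ) : ℝ) ≤ x := by have := hx.1; norm_num at this ⊢; exact this
  have a1 := step _ _ (by norm_num) (by norm_num) h1 hx0
  have a2 := step _ _ (by norm_num) (by norm_num) h2 a1.le
  have a3 := step _ _ (by norm_num) (by norm_num) h3 a2.le
  have a4 := step _ _ (by norm_num) (by norm_num) h4 a3.le
  have a5 := step _ _ (by norm_num) (by norm_num) h5 a4.le
  have a6 := step _ _ (by norm_num) (by norm_num) h6 a5.le
  have a7 := step _ _ (by norm_num) (by norm_num) h7 a6.le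
  have a8 := step _ _ (by norm_num) (by norm_num) h8 a7.le
  have a9 := step _ _ (by norm_num) (by norm_num) h9 a8.le
  have := hx.2
  norm_num at this a9
  linarith

theorem ediam_sublevel_le {l : List ℤ} (hl : IsSignList l) {ε : ℝ} (hε : ε ≤ 1 / 10 ^ 6)
    {s : Set ℝ} (hs : s ⊆ Set.Icc (1 / 2 : ℝ) 0.668)
    (hdiam : ∀ x ∈ s, ∀ y ∈ s, |y - x| ≤ 1 / (110 * 10 ^ 6))
    (hsmall : ∀ x ∈ s, |evalList x (1 :: l)| ≤ ε) :
    Metric.ediam s ≤ ENNReal.ofReal (4 * 10 ^ 6 * ε) := by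
  have key : ∀ x ∈ s, ∀ y ∈ s, x < y → y - x ≤ 4 * 10 ^ 6 * ε := by
    intro x hx y hy hxy
    obtain ⟨z, hz, hz'⟩ := exists_hasDerivAt_eq_slope (fun w => evalList w (1 :: l))
      (fun w => evalListDeriv w (1 :: l)) hxy
      (fun w _ => (hasDerivAt_evalList _ w).continuousAt.continuousWithinAt)
      (fun w _ => hasDerivAt_evalList _ w)
    have hzI : z ∈ Set.Icc (1 / 2 : ℝ) 0.668 :=
      ⟨(hs hx).1.trans hz.1.le, hz.2.le.trans (hs hy).2⟩
    have h1 := transversality hl (hs hx) ((hsmall x hx).trans hε)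
    have h2 := abs_evalListDeriv_sub_le hl.one_cons hzI (hs hx)
    have h3 := abs_sub_abs_le_abs_sub (evalListDeriv x (1 :: l)) (evalListDeriv z (1 :: l))
    have h4 : |x - z| ≤ 1 / (110 * 10 ^ 6) := by
      have := hdiam x hx y hy
      rw [abs_of_pos (sub_pos.2 hxy)] at this
      exact abs_le.2 ⟨by linarith [hz.2], by linarith [hz.1]⟩
    have h5 : 1 / (2 * 10 ^ 6) ≤ |evalListDeriv z (1 :: l)| := by
      norm_num at h1 h4 ⊢; linarith
    have h6 : evalListDeriv z (1 :: l) * (y - x) = evalList y (1 :: l) - evalList x (1 :: l) := by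
      rw [hz', div_mul_cancel₀ _ (sub_pos.2 hxy).ne']
    have h7 : |evalListDeriv z (1 :: l)| * (y - x) ≤ ε + ε := by
      rw [← abs_of_pos (sub_pos.2 hxy), ← abs_mul, h6]
      exact (abs_sub _ _).trans (add_le_add (hsmall y hy) (hsmall x hx))
    have h8 : 1 / (2 * 10 ^ 6) * (y - x) ≤ |evalListDeriv z (1 :: l)| * (y - x) := by
      gcongr
    norm_num at h8 ⊢; linarith
  refine Metric.ediam_le fun x hx y hy => ?_
  rw [edist_dist, Real.dist_eq]
  refine ENNReal.ofReal_le_ofReal ?_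
  have hε0 : 0 ≤ ε := (abs_nonneg _).trans (hsmall x hx)
  rcases lt_trichotomy x y with h | rfl | h
  · rw [abs_sub_comm, abs_of_pos (sub_pos.2 h)]; exact key x hx y hy h
  · simpa using hε0
  · rw [abs_of_pos (sub_pos.2 h)]; exact key y hy x hx h

theorem exists_volume_sublevel_le : ∃ C : ℝ, 0 < C ∧ ∀ l : List ℤ, IsSignList l → ∀ ε : ℝ, 0 ≤ ε →
    volume {x ∈ Set.Icc (1 / 2 : ℝ) 0.668 | |evalList x (1 :: l)| ≤ ε} ≤
      ENNReal.ofReal (C * ε) := by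
  obtain ⟨N, hN⟩ := exists_nat_gt (110 * 10 ^ 6 : ℝ)
  have hN0 : (0 : ℝ) < N := lt_trans (by norm_num) hN
  refine ⟨N * (4 * 10 ^ 6), by positivity, fun l hl ε hε => ?_⟩
  rcases le_or_gt ε (1 / 10 ^ 6) with hε' | hε'
  · set S : ℕ → Set ℝ := fun i => {x ∈ Set.Icc (1 / 2 : ℝ) 0.668 | |evalList x (1 :: l)| ≤ ε ∧
      ⌊(x - 1 / 2) * (110 * 10 ^ 6)⌋₊ = i}
    have hcover : {x ∈ Set.Icc (1 / 2 : ℝ) 0.668 | |evalList x (1 :: l)| ≤ ε} ⊆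
        ⋃ i ∈ Finset.range N, S i := by
      rintro x ⟨hx, hxε⟩
      simp only [Set.mem_iUnion, Finset.mem_range]
      refine ⟨⌊(x - 1 / 2) * (110 * 10 ^ 6)⌋₊, ?_, hx, hxε, rfl⟩
      have hx1 := hx.1
      have hx2 := hx.2
      rw [Nat.floor_lt (by apply mul_nonneg <;> norm_num at hx1 ⊢; linarith)]
      norm_num at hx1 hx2 ⊢; linarith
    calc _ ≤ volume (⋃ i ∈ Finset.range N, S i) := measure_mono hcover
      _ ≤ ∑ i ∈ Finset.range N, volume (S i) := measure_biUnion_finset_le _ _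
      _ ≤ ∑ i ∈ Finset.range N, ENNReal.ofReal (4 * 10 ^ 6 * ε) := by
        refine Finset.sum_le_sum fun i _ => (Real.volume_le_diam _).trans ?_
        refine ediam_sublevel_le hl hε' (fun x hx => hx.1) ?_ fun x hx => hx.2.1
        have hfl : ∀ x ∈ S i, (i : ℝ) ≤ (x - 1 / 2) * (110 * 10 ^ 6) ∧
            (x - 1 / 2) * (110 * 10 ^ 6) < i + 1 := by
          rintro x ⟨hx, -, rfl⟩
          have hx1 := hx.1
          exact ⟨Nat.floor_le (mul_nonneg (by linarith) (by norm_num)), Nat.lt_floor_add_one _⟩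
        intro x hx y hy
        have := hfl x hx
        have := hfl y hy
        rw [abs_le]
        constructor <;> norm_num at * <;> linarith
      _ = ENNReal.ofReal (N * (4 * 10 ^ 6) * ε) := by
        rw [Finset.sum_const, Finset.card_range, nsmul_eq_mul, mul_assoc (N : ℝ),
          ENNReal.ofReal_mul hN0.le, ENNReal.ofReal_natCast]
  · calc _ ≤ volume (Set.Icc (1 / 2 : ℝ) 0.668) := measure_mono fun x hx => hx.1
      _ = ENNReal.ofReal (0.668 - 1 / 2) := Real.volume_Icc
      _ ≤ _ := by
        refine ENNReal.ofReal_le_ofReal ?_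
        have h1 : (110 * 10 ^ 6 : ℝ) * (4 * 10 ^ 6) * (1 / 10 ^ 6) ≤ N * (4 * 10 ^ 6) * ε := by
          gcongr
        norm_num at h1 ⊢; linarith

/-- The polynomial with digits `i`, evaluated at `x`. -/
noncomputable def digitSum {n : ℕ} (i : Fin n → Fin 2) (x : ℝ) : ℝ :=
  ∑ k : Fin n, ((i k : ℕ) : ℝ) * x ^ (k : ℕ)

theorem digitSum_cons {n : ℕ} (b : Fin 2) (i : Fin n → Fin 2) (x : ℝ) :
    digitSum (Fin.cons b i : Fin (n + 1) → Fin 2) x = (b : ℕ) + x * digitSum i x := by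
  simp only [digitSum, Fin.sum_univ_succ, Fin.cons_zero, Fin.cons_succ, Fin.val_zero, pow_zero,
    mul_one, Fin.val_succ, Finset.mul_sum, pow_succ]
  congr 1
  exact Finset.sum_congr rfl fun k _ => by ring

theorem continuous_digitSum {n : ℕ} (i : Fin n → Fin 2) : Continuous (digitSum i) := by
  unfold digitSum; fun_prop

theorem exists_digitSum_sub_eq {n : ℕ} (i j : Fin n → Fin 2) :
    ∃ l, IsSignList l ∧ ∀ x, digitSum i x - digitSum j x = evalList x l := by
  induction n with
  | zero => exact ⟨[], by simp [IsSignList], fun x => by simp [digitSum, evalList]⟩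
  | succ n ih =>
    obtain ⟨l, hl, h⟩ := ih (Fin.tail i) (Fin.tail j)
    refine ⟨((i 0 : ℕ) - (j 0 : ℕ) : ℤ) :: l, ?_, fun x => ?_⟩
    · intro b hb
      rcases List.mem_cons.1 hb with rfl | hb
      · have := (i 0).isLt
        have := (j 0).isLt
        omega
      · exact hl b hb
    · rw [← Fin.cons_self_tail i, ← Fin.cons_self_tail j, digitSum_cons, digitSum_cons]
      simp only [evalList, ← h, Fin.cons_zero]
      push_cast; ring

/-- The parameters in `[a, 0.668]` at which the digit sums of `i` and `j` are `ε`-close. -/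
def closeSet (a ε : ℝ) {n : ℕ} (i j : Fin n → Fin 2) : Set ℝ :=
  {x ∈ Set.Icc a 0.668 | |digitSum i x - digitSum j x| ≤ ε}

theorem measurableSet_closeSet (a ε : ℝ) {n : ℕ} (i j : Fin n → Fin 2) :
    MeasurableSet (closeSet a ε i j) :=
  (isClosed_Icc.inter (isClosed_le ((continuous_digitSum i).sub (continuous_digitSum j)).abs
    continuous_const)).measurableSet

theorem closeSet_cons_self_subset {a : ℝ} (ha : 0 < a) (ε : ℝ) {n : ℕ} (b : Fin 2)
    (i j : Fin n → Fin 2) :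
    closeSet a ε (Fin.cons b i : Fin (n + 1) → Fin 2) (Fin.cons b j) ⊆
      closeSet a (ε / a) i j := by
  rintro x ⟨hx, h⟩
  refine ⟨hx, ?_⟩
  rw [digitSum_cons, digitSum_cons, add_sub_add_left_eq_sub, ← mul_sub, abs_mul,
    abs_of_pos (ha.trans_le hx.1)] at h
  rw [le_div_iff₀ ha, mul_comm]
  exact (mul_le_mul_of_nonneg_right hx.1 (abs_nonneg _)).trans h

theorem volume_closeSet_cons_le {C : ℝ}
    (hC : ∀ l : List ℤ, IsSignList l → ∀ ε : ℝ, 0 ≤ ε →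
      volume {x ∈ Set.Icc (1 / 2 : ℝ) 0.668 | |evalList x (1 :: l)| ≤ ε} ≤ ENNReal.ofReal (C * ε))
    {a ε : ℝ} (ha : 1 / 2 ≤ a) (hε : 0 ≤ ε) {n : ℕ} {b c : Fin 2} (hbc : b ≠ c)
    (i j : Fin n → Fin 2) :
    volume (closeSet a ε (Fin.cons b i : Fin (n + 1) → Fin 2) (Fin.cons c j)) ≤
      ENNReal.ofReal (C * ε) := by
  have key : ∀ i j : Fin n → Fin 2,
      volume (closeSet a ε (Fin.cons 1 i : Fin (n + 1) → Fin 2) (Fin.cons 0 j)) ≤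
        ENNReal.ofReal (C * ε) := by
    intro i j
    obtain ⟨l, hl, h⟩ := exists_digitSum_sub_eq i j
    refine (measure_mono ?_).trans (hC l hl ε hε)
    rintro x ⟨hx, hxε⟩
    refine ⟨⟨ha.trans hx.1, hx.2⟩, ?_⟩
    convert hxε using 2
    rw [digitSum_cons, digitSum_cons]
    simp only [evalList, ← h]
    push_cast
    simp; ring
  have hsymm : closeSet a ε (Fin.cons b i : Fin (n + 1) → Fin 2) (Fin.cons c j) =
      closeSet a ε (Fin.cons c j : Fin (n + 1) → Fin 2) (Fin.cons b i) := by
    simp only [closeSet, abs_sub_comm]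
  fin_cases b <;> fin_cases c
  · exact absurd rfl hbc
  · rw [hsymm]; exact key j i
  · exact key i j
  · exact absurd rfl hbc

open Classical in
/-- The total measure of the close sets over all ordered pairs of distinct digit sequences. -/
noncomputable def pairMass (a ε : ℝ) (n : ℕ) : ENNReal :=
  ∑ i : Fin n → Fin 2, ∑ j : Fin n → Fin 2, if i = j then 0 else volume (closeSet a ε i j)

theorem pairMass_succ_le {C : ℝ}
    (hC : ∀ l : List ℤ, IsSignList l → ∀ ε : ℝ, 0 ≤ ε →
      volume {x ∈ Set.Icc (1 / 2 : ℝ) 0.668 | |evalList x (1 :: l)| ≤ ε} ≤ ENNReal.ofReal (C * ε))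
    {a ε : ℝ} (ha : 1 / 2 ≤ a) (hε : 0 ≤ ε) (n : ℕ) :
    pairMass a ε (n + 1) ≤ 2 * pairMass a (ε / a) n + 2 * 4 ^ n * ENNReal.ofReal (C * ε) := by
  classical
  have hsum : ∀ f : (Fin (n + 1) → Fin 2) → ENNReal,
      ∑ i, f i = ∑ b : Fin 2, ∑ i : Fin n → Fin 2, f (Fin.cons b i) := fun f => by
    rw [← Fintype.sum_prod_type']
    exact (Equiv.sum_comp (Fin.consEquiv fun _ => Fin 2) f).symm
  let W : Fin 2 → Fin 2 → ENNReal := fun b c =>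
    ∑ i : Fin n → Fin 2, ∑ j : Fin n → Fin 2,
      if (Fin.cons b i : Fin (n + 1) → Fin 2) = Fin.cons c j then 0
      else volume (closeSet a ε (Fin.cons b i : Fin (n + 1) → Fin 2) (Fin.cons c j))
  have hsplit : pairMass a ε (n + 1) = ∑ b, ∑ c, W b c := by
    rw [pairMass, hsum]
    refine Finset.sum_congr rfl fun b _ => ?_
    exact (Finset.sum_congr rfl fun i _ => hsum _).trans Finset.sum_comm
  have hsame : ∀ b, W b b ≤ pairMass a (ε / a) n := by
    intro b
    refine Finset.sum_le_sum fun i _ => Finset.sum_le_sum fun j _ => ?_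
    by_cases hij : i = j
    · simp [hij]
    · rw [if_neg hij, if_neg fun h => hij (Fin.cons_right_injective (α := fun _ => Fin 2) b h)]
      exact measure_mono (closeSet_cons_self_subset (by linarith) ε b i j)
  have hdiff : ∀ b c, b ≠ c → W b c ≤ 4 ^ n * ENNReal.ofReal (C * ε) := by
    intro b c hbc
    calc W b c ≤ ∑ i : Fin n → Fin 2, ∑ j : Fin n → Fin 2, ENNReal.ofReal (C * ε) := by
          refine Finset.sum_le_sum fun i _ => Finset.sum_le_sum fun j _ => ?_
          split_ifs
          · exact zero_le
          · exact volume_closeSet_cons_le hC ha hε hbc i j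
      _ = 4 ^ n * ENNReal.ofReal (C * ε) := by
          simp only [Finset.sum_const, Finset.card_univ, Fintype.card_fun, Fintype.card_fin,
            nsmul_eq_mul]
          rw [← mul_assoc]
          push_cast
          rw [← mul_pow]; norm_num
  rw [hsplit, Fin.sum_univ_two, Fin.sum_univ_two, Fin.sum_univ_two]
  calc W 0 0 + W 0 1 + (W 1 0 + W 1 1)
      ≤ pairMass a (ε / a) n + 4 ^ n * ENNReal.ofReal (C * ε)
        + (4 ^ n * ENNReal.ofReal (C * ε) + pairMass a (ε / a) n) := by
        gcongr
        · exact hsame 0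
        · exact hdiff 0 1 (by decide)
        · exact hdiff 1 0 (by decide)
        · exact hsame 1
    _ = _ := by ring

theorem exists_pairMass_le {a : ℝ} (ha : 1 / 2 < a) :
    ∃ K : ℝ, 0 < K ∧ ∀ n : ℕ, ∀ ε : ℝ, 0 ≤ ε →
      pairMass a ε n ≤ ENNReal.ofReal (K * 4 ^ n * ε) := by
  obtain ⟨C, hC0, hC⟩ := exists_volume_sublevel_le
  have ha0 : 0 < a := by linarith
  have hgap : 0 < 2 - 1 / a := by
    rw [sub_pos, div_lt_iff₀ ha0]; linarith
  refine ⟨C / (2 - 1 / a), by positivity, fun n => ?_⟩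
  set K := C / (2 - 1 / a) with hK
  have hK0 : 0 < K := by positivity
  have hKC : C = K * (2 - 1 / a) := by rw [hK, div_mul_cancel₀ _ hgap.ne']
  induction n with
  | zero =>
    intro ε _
    rw [pairMass, Finset.sum_eq_zero fun i _ => Finset.sum_eq_zero fun j _ =>
      if_pos (Subsingleton.elim i j)]
    exact zero_le
  | succ n ih =>
    intro ε hε
    have hεa : 0 ≤ ε / a := by positivity
    refine (pairMass_succ_le hC ha.le hε n).trans ?_
    calc 2 * pairMass a (ε / a) n + 2 * 4 ^ n * ENNReal.ofReal (C * ε)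
        ≤ 2 * ENNReal.ofReal (K * 4 ^ n * (ε / a)) + 2 * 4 ^ n * ENNReal.ofReal (C * ε) := by
          gcongr; exact ih _ hεa
      _ = ENNReal.ofReal (2 * (K * 4 ^ n * (ε / a)) + 2 * 4 ^ n * (C * ε)) := by
          rw [ENNReal.ofReal_add (by positivity) (by positivity),
            ENNReal.ofReal_mul (by norm_num : (0 : ℝ) ≤ 2),
            ENNReal.ofReal_mul (by positivity : (0 : ℝ) ≤ 2 * 4 ^ n),
            ENNReal.ofReal_mul (by norm_num : (0 : ℝ) ≤ 2), ENNReal.ofReal_pow (by norm_num)]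
          norm_num
      _ = ENNReal.ofReal (K * 4 ^ (n + 1) * ε) := by
          congr 1
          rw [hKC, pow_succ]; field_simp; ring

open Classical in
/-- The number of ordered pairs of distinct digit sequences that are `ε`-close at `x`. -/
noncomputable def closeCount (a ε : ℝ) (n : ℕ) (x : ℝ) : ENNReal :=
  ∑ i : Fin n → Fin 2, ∑ j : Fin n → Fin 2,
    if i = j then 0 else (closeSet a ε i j).indicator 1 x

theorem measurable_ite_indicator_closeSet (a ε : ℝ) {n : ℕ} (i j : Fin n → Fin 2)
    (p : Prop) [Decidable p] :
    Measurable fun x => if p then (0 : ENNReal) else (closeSet a ε i j).indicator 1 x := by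
  split_ifs
  · exact measurable_const
  · exact measurable_one.indicator (measurableSet_closeSet a ε i j)

theorem measurable_closeCount (a ε : ℝ) (n : ℕ) : Measurable (closeCount a ε n) :=
  Finset.measurable_fun_sum _ fun i _ => Finset.measurable_fun_sum _ fun j _ =>
    measurable_ite_indicator_closeSet a ε i j _

theorem lintegral_closeCount (a ε : ℝ) (n : ℕ) :
    ∫⁻ x, closeCount a ε n x = pairMass a ε n := by
  classical
  simp only [closeCount, pairMass]
  rw [lintegral_finsetSum _ fun i _ => Finset.measurable_fun_sum _ fun j _ =>
    measurable_ite_indicator_closeSet a ε i j _]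
  refine Finset.sum_congr rfl fun i _ => ?_
  rw [lintegral_finsetSum _ fun j _ => measurable_ite_indicator_closeSet a ε i j _]
  refine Finset.sum_congr rfl fun j _ => ?_
  split_ifs
  · simp
  · exact lintegral_indicator_one (measurableSet_closeSet a ε i j)

theorem ae_eventually_closeCount_lt {a : ℝ} (ha : 1 / 2 < a) :
    ∀ᵐ x : ℝ, ∀ᶠ n : ℕ in atTop,
      closeCount a (4 * (1 / ((n : ℝ) ^ 2 * 2 ^ n))) n x < 2 ^ (n - 1) := by
  obtain ⟨K, hK0, hK⟩ := exists_pairMass_le ha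
  have hsum : Summable fun n : ℕ => 8 * K * (1 / (n : ℝ) ^ 2) :=
    (Real.summable_one_div_nat_pow.2 one_lt_two).mul_left _
  have hbound : ∀ n : ℕ,
      volume {x | 2 ^ (n - 1) ≤ closeCount a (4 * (1 / ((n : ℝ) ^ 2 * 2 ^ n))) n x} ≤
        ENNReal.ofReal (8 * K * (1 / (n : ℝ) ^ 2)) := by
    intro n
    refine (meas_ge_le_lintegral_div (measurable_closeCount _ _ _).aemeasurable (by simp)
      (by simp)).trans ?_
    rw [lintegral_closeCount]
    refine ENNReal.div_le_of_le_mul ((hK n _ (by positivity)).trans ?_)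
    have h2 : (2 : ENNReal) ^ (n - 1) = ENNReal.ofReal (2 ^ (n - 1)) := by
      rw [ENNReal.ofReal_pow (by norm_num)]; norm_num
    rw [h2, ← ENNReal.ofReal_mul (by positivity)]
    refine ENNReal.ofReal_le_ofReal (le_of_eq ?_)
    cases n with
    | zero => simp
    | succ m =>
      have h4 : (4 : ℝ) ^ (m + 1) = 2 ^ (m + 1) * 2 ^ (m + 1) := by rw [← mul_pow]; norm_num
      rw [h4, Nat.add_sub_cancel]
      have : ((m + 1 : ℕ) : ℝ) ≠ 0 := by positivity
      field_simp
      ring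
  have hne := ne_top_of_le_ne_top hsum.tsum_ofReal_ne_top (ENNReal.tsum_le_tsum hbound)
  filter_upwards [ae_eventually_notMem hne] with x hx
  filter_upwards [hx] with n hn
  exact not_le.1 hn

theorem two_pow_le_ncard_separated {a x : ℝ} (hx : x ∈ Set.Ioo a 0.668) {n : ℕ}
    (hn : 1 ≤ n) {ε : ℝ} (hε : 0 ≤ ε) (h : closeCount a (4 * ε) n x < 2 ^ (n - 1)) :
    2 ^ (n - 1) ≤ {y ∈ Aset x n | ∀ z ∈ Aset x n, z ≠ y → ε < |y - z|}.ncard := by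
  classical
  have hx1 : 1 / 4 ≤ 1 - x := by have := hx.2; norm_num at this ⊢; linarith
  set φ : (Fin n → Fin 2) → ℝ := fun i => (1 - x) * digitSum i x with hφ
  have hA : Aset x n = Set.range φ := by
    ext y; exact ⟨fun ⟨i, hi⟩ => ⟨i, hi.symm⟩, fun ⟨i, hi⟩ => ⟨i, hi.symm⟩⟩
  set bad : Finset (Fin n → Fin 2) := {i | ∃ j, i ≠ j ∧ |φ i - φ j| ≤ ε}
  have hclose : ∀ i j, |φ i - φ j| ≤ ε → x ∈ closeSet a (4 * ε) i j := by
    intro i j hij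
    refine ⟨⟨hx.1.le, hx.2.le⟩, ?_⟩
    rw [hφ, ← mul_sub, abs_mul, abs_of_nonneg (by linarith : 0 ≤ 1 - x)] at hij
    have := mul_le_mul_of_nonneg_right hx1 (abs_nonneg (digitSum i x - digitSum j x))
    linarith
  have hcount : (bad.card : ENNReal) ≤ closeCount a (4 * ε) n x := by
    rw [Finset.card_eq_sum_ones, Nat.cast_sum, closeCount]
    refine (Finset.sum_le_sum fun i hi => ?_).trans
      (Finset.sum_le_sum_of_subset (Finset.subset_univ bad))
    obtain ⟨j, hij, hj⟩ := (Finset.mem_filter.1 hi).2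
    refine le_trans ?_ (Finset.single_le_sum (fun _ _ => zero_le) (Finset.mem_univ j))
    rw [if_neg hij, Set.indicator_of_mem (hclose i j hj)]
    simp
  have hbad_lt : bad.card < 2 ^ (n - 1) := by exact_mod_cast hcount.trans_lt h
  have hgood : 2 ^ (n - 1) ≤ badᶜ.card := by
    rw [Finset.card_compl, Fintype.card_fun, Fintype.card_fin, Fintype.card_fin]
    have : 2 ^ n = 2 ^ (n - 1) * 2 := by rw [← pow_succ, Nat.sub_add_cancel hn]
    omega
  have hsep : ∀ i ∈ badᶜ, ∀ j, i ≠ j → ε < |φ i - φ j| := by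
    intro i hi j hij
    by_contra! hle
    exact Finset.mem_compl.1 hi (Finset.mem_filter.2 ⟨Finset.mem_univ i, j, hij, hle⟩)
  rw [hA]
  refine hgood.trans ?_
  rw [← Set.ncard_coe_finset]
  refine Set.ncard_le_ncard_of_injOn φ ?_ ?_ ((Set.finite_range φ).subset fun y hy => hy.1)
  · rintro i hi
    refine ⟨⟨i, rfl⟩, ?_⟩
    rintro _ ⟨j, rfl⟩ hji
    exact hsep i hi j fun hij => hji (hij ▸ rfl)
  · intro i hi j _ hij
    by_contra hne
    have := hsep i hi j hne
    rw [hij, sub_self, abs_zero] at this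
    linarith

/-- For Lebesgue almost every `λ ∈ (1/2, 0.668)`, for all but finitely many `n`, at least
`2^{n-1}` elements of `A_n(λ)` are `1/(n² 2^n)`-separated from every other element. -/
theorem generic_separation_eventually :
    ∀ᵐ lam ∂(volume.restrict (Set.Ioo (1 / 2 : ℝ) 0.668)),
      ∀ᶠ n : ℕ in atTop,
        2 ^ (n - 1) ≤
          {a ∈ Aset lam n |
            ∀ b ∈ Aset lam n, b ≠ a → 1 / ((n : ℝ) ^ 2 * 2 ^ n) < |a - b|}.ncard := by
  rw [ae_restrict_iff' measurableSet_Ioo]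
  have hae : ∀ᵐ x : ℝ, ∀ m : ℕ, ∀ᶠ n : ℕ in atTop,
      closeCount (1 / 2 + 1 / (m + 1)) (4 * (1 / ((n : ℝ) ^ 2 * 2 ^ n))) n x < 2 ^ (n - 1) :=
    ae_all_iff.2 fun m => ae_eventually_closeCount_lt (by
      have : (0 : ℝ) < 1 / (m + 1) := by positivity
      linarith)
  filter_upwards [hae] with x hx hxI
  obtain ⟨m, hm⟩ := exists_nat_one_div_lt (sub_pos.2 hxI.1)
  filter_upwards [hx m, eventually_ge_atTop 1] with n hn hn1
  exact two_pow_le_ncard_separated ⟨by linarith, hxI.2⟩ hn1 (by positivity) hn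
end
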